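/- Let $A_\Gamma$ be a 3-free Artin group and let $a, b, c \in X$ be pairwise distinct generators with $m(a,b) > 3$ and $m(b,c) > 3$. Let $\delta_1, \delta_2, \delta_3, \delta_4 \in \{1,-1\}$ and let $w b^{\delta_1} c^{\delta_2} b^{\delta_3} a^{\delta_4}$ be a geodesic word over $X$. Then every geodesic word over $X$ representing the same element of $A_\Gamma$ ends in a letter of the form $a^{\pm 1}$ or $z^{\pm 1}$ for some $z \in X$ with $m(a,z) = 2$ (i.e., a letter that commutes with $a$). -/

import Mathlib

/-- The alternating product `x y x y ⋯` of length `n` in the free group, starting with `x`. -/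
def altProd {X : Type*} : ℕ → X → X → FreeGroup X
  | 0, _, _ => 1
  | n + 1, x, y => FreeGroup.of x * altProd n y x

/-- The Artin relations associated to a labelling `m : X → X → ℕ∞` (label `⊤` = no relation):
for each pair `x ≠ y` with finite label `k`, the relator `(xyx⋯)(yxy⋯)⁻¹` (both of length `k`). -/
def artinRels {X : Type*} (m : X → X → ℕ∞) : Set (FreeGroup X) :=
  { r | ∃ (x y : X) (k : ℕ), x ≠ y ∧ m x y = (k : ℕ∞) ∧
      r = altProd k x y * (altProd k y x)⁻¹ }

/-- The Artin group of the labelled graph encoded by `m`. -/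
abbrev ArtinGroup {X : Type*} (m : X → X → ℕ∞) : Type _ := PresentedGroup (artinRels m)

/-- The standard generators of the Artin group. -/
def artinGen {X : Type*} (m : X → X → ℕ∞) (x : X) : ArtinGroup m := PresentedGroup.of x

/-- The Artin monoid: the submonoid of the Artin group generated by the standard generators. -/
def artinMonoid {X : Type*} (m : X → X → ℕ∞) : Submonoid (ArtinGroup m) :=
  Submonoid.closure (Set.range (artinGen m))

/-- The monoid word metric on a group `G` relative to a submonoid `M`: `monoidDist M g h` is the
least `n` such that `g⁻¹ * h` is a product of `n` elements each lying in `M` or `M⁻¹`. -/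
noncomputable def monoidDist {G : Type*} [Group G] (M : Submonoid G) (g h : G) : ℕ :=
  sInf { n : ℕ | ∃ l : List G, l.length = n ∧ (∀ a ∈ l, a ∈ M ∨ a⁻¹ ∈ M) ∧ g⁻¹ * h = l.prod }

/-- A word over `X`: a list of letters `x^ε`, where `ε = true` denotes the positive letter `x`
and `ε = false` the negative letter `x⁻¹`. -/
abbrev Word (X : Type*) := List (X × Bool)

/-- The element of `G` represented by a word over `X`, given `f : X → G`. -/
def evalWord {X G : Type*} [Group G] (f : X → G) (w : Word X) : G :=
  (w.map (fun p => if p.2 then f p.1 else (f p.1)⁻¹)).prod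

/-- A word is positive if all its letters are positive. -/
def IsPosWord {X : Type*} (w : Word X) : Prop := ∀ p ∈ w, p.2 = true

/-- A word is negative if all its letters are negative. -/
def IsNegWord {X : Type*} (w : Word X) : Prop := ∀ p ∈ w, p.2 = false

/-- A word is geodesic if no strictly shorter word represents the same element of `G`. -/
def IsGeodesic {X G : Type*} [Group G] (f : X → G) (w : Word X) : Prop :=
  ∀ v : Word X, evalWord f v = evalWord f w → w.length ≤ v.length

/-- `(u, x)` is a blocking pair if for every word `w` such that `w ++ u` is geodesic,
the word `w ++ u ++ [x]` is also geodesic. -/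
def BlockingPair {X G : Type*} [Group G] (f : X → G) (u : Word X) (x : X × Bool) : Prop :=
  ∀ w : Word X, IsGeodesic f (w ++ u) → IsGeodesic f (w ++ u ++ [x])

/-- An alternating blocking sequence `(α n)` (indexed from `n = 1`; the value `α 0` is ignored):
each `α n` is nonempty, positive for odd `n` and negative for even `n`, and every letter `x`
of `α n` is immediately preceded, within `α (n-1) ++ α n` (with `α 0` read as the empty word),
by a subword `u` such that `(u, x)` is a blocking pair. -/
def IsAltBlockingSeq {X G : Type*} [Group G] (f : X → G) (α : ℕ → Word X) : Prop :=
  (∀ n, 1 ≤ n → α n ≠ []) ∧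
  (∀ n, 1 ≤ n → Odd n → IsPosWord (α n)) ∧
  (∀ n, 1 ≤ n → Even n → IsNegWord (α n)) ∧
  (∀ n, 1 ≤ n → ∀ p x s, α n = p ++ x :: s →
    ∃ u : Word X, u <:+ ((if n = 1 then ([] : Word X) else α (n - 1)) ++ p) ∧
      BlockingPair f u x)

/-- `u` is the longest positive (`ε = true`) resp. negative (`ε = false`) proper suffix of `w`. -/
def IsLongestSignedProperSuffix {X : Type*} (ε : Bool) (w u : Word X) : Prop :=
  u <:+ w ∧ u ≠ w ∧ (∀ p ∈ u, p.2 = ε) ∧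
    ∀ v : Word X, v <:+ w → v ≠ w → (∀ p ∈ v, p.2 = ε) → v.length ≤ u.length

/-- Preserved positive (`ε = true`) resp. negative (`ε = false`) suffixes: whenever `w` is a
geodesic word ending in a letter of sign `ε`, `u` is the longest proper suffix of `w` of sign `ε`,
and `a` is a generator, the element represented by `a^ε · w` admits a geodesic representative
having `u` as a suffix. -/
def PreservedSignSuffixes {X G : Type*} [Group G] (ε : Bool) (f : X → G) : Prop :=
  ∀ (w : Word X) (y : X), IsGeodesic f w → w.getLast? = some (y, ε) →
    ∀ u : Word X, IsLongestSignedProperSuffix ε w u →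
    ∀ a : X, ∃ w' : Word X, IsGeodesic f w' ∧
      evalWord f w' = evalWord f ((a, ε) :: w) ∧ u <:+ w'

/-- Preserved signed suffixes: both preserved positive and preserved negative suffixes. -/
def PreservedSignedSuffixes {X G : Type*} [Group G] (f : X → G) : Prop :=
  PreservedSignSuffixes true f ∧ PreservedSignSuffixes false f

namespace Dihedral

/-- Normal forms `Δ ^ d * s₁ * ⋯ * sₖ` of the dihedral Artin group: `base d` is `Δ ^ d`, and
`top d v l e` has last factor of length `v` ending in the generator `e`, the lengths of the
earlier factors being listed (from right to left) in `l`. -/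
inductive State : Type
  | base (d : ℤ) : State
  | top (d : ℤ) (v : ℕ) (l : List ℕ) (e : Bool) : State

open State

/-- The normal form with exponent `d`, factor lengths `l` and last letter `e`. -/
def ofList (d : ℤ) : List ℕ → Bool → State
  | [], _ => base d
  | v :: l, e => top d v l e

/-- Right multiplication of a normal form by a letter, in the dihedral Artin group of label `m`. -/
def act (m : ℕ) : Bool × Bool → State → State
  | (z, true), base d => top d 1 [] z
  | (z, true), top d v l e =>
      if z = e then top d 1 (v :: l) e
      else if v + 1 < m then top d (v + 1) l z else ofList (d + 1) l e
  | (z, false), base d => top (d - 1) (m - 1) [] (!z)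
  | (z, false), top d v l e =>
      if z = e then (if v = 1 then ofList d l e else top d (v - 1) l (!e))
      else top (d - 1) (m - 1) (v :: l) e

/-- All factor lengths lie strictly between `0` and `m`. -/
def WF (m : ℕ) : State → Prop
  | base _ => True
  | top _ v l _ => ∀ u ∈ v :: l, 1 ≤ u ∧ u < m

/-- The inverse letter. -/
def inv {X : Type*} (s : X × Bool) : X × Bool := (s.1, !s.2)

@[simp] theorem inv_inv {X : Type*} (s : X × Bool) : inv (inv s) = s := by simp [inv]

theorem eq_or_eq_inv {X : Type*} {s t : X × Bool} (h : s.1 = t.1) : s = t ∨ s = inv t := by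
  obtain ⟨x, b⟩ := s
  obtain ⟨y, c⟩ := t
  cases b <;> cases c <;> simp_all [inv]

theorem wf_ofList {m : ℕ} {d : ℤ} {l : List ℕ} {e : Bool} (h : ∀ u ∈ l, 1 ≤ u ∧ u < m) :
    WF m (ofList d l e) := by
  cases l <;> simp_all [ofList, WF]

theorem wf_act {m : ℕ} (hm : 2 ≤ m) (s : Bool × Bool) {ξ : State} (h : WF m ξ) :
    WF m (act m s ξ) := by
  obtain ⟨z, ε⟩ := s
  cases ξ with
  | base d => cases ε <;> simp [act, WF] <;> omega
  | top d v l e =>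
    have hl : ∀ u ∈ l, 1 ≤ u ∧ u < m := fun u hu => h u (List.mem_cons_of_mem _ hu)
    have hv : 1 ≤ v ∧ v < m := h v List.mem_cons_self
    cases ε <;> simp only [act] <;> split_ifs <;>
      first
      | exact wf_ofList hl
      | (intro u hu
         simp only [List.mem_cons] at hu
         rcases hu with rfl | rfl | hu <;> first | omega | exact hl _ hu)
      | (intro u hu
         simp only [List.mem_cons] at hu
         rcases hu with rfl | hu <;> first | omega | exact hl _ hu)

theorem act_inv_act {m : ℕ} (hm : 2 ≤ m) (s : Bool × Bool) {ξ : State} (h : WF m ξ) :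
    act m (inv s) (act m s ξ) = ξ := by
  obtain ⟨z, ε⟩ := s
  cases ξ with
  | base d =>
    cases ε <;> cases z <;> simp [act, inv, ofList] <;> omega
  | top d v l e =>
    have hv : 1 ≤ v ∧ v < m := h v List.mem_cons_self
    have h1 : ¬ v + 1 < m → m - 1 = v := by omega
    have h2 : v ≠ 1 → v - 1 + 1 < m := by omega
    have h3 : v - 1 + 1 = v := by omega
    have h4 : ¬ m - 1 + 1 < m := by omega
    have h5 : v + 1 ≠ 1 := by omega
    have h6 : v < m := hv.2
    cases ε <;> cases z <;> cases e <;> simp only [act, inv] <;> (try split_ifs) <;>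
      cases l <;> simp_all [ofList]

theorem act_act_inv {m : ℕ} (hm : 2 ≤ m) (s : Bool × Bool) {ξ : State} (h : WF m ξ) :
    act m s (act m (inv s) ξ) = ξ := by
  simpa using act_inv_act hm (inv s) h

/-- Right multiplication by a word. -/
def run (m : ℕ) (w : List (Bool × Bool)) (ξ : State) : State :=
  w.foldl (fun ξ s => act m s ξ) ξ

@[simp] theorem run_nil (m : ℕ) (ξ : State) : run m [] ξ = ξ := rfl

@[simp] theorem run_cons (m : ℕ) (s) (w) (ξ : State) :
    run m (s :: w) ξ = run m w (act m s ξ) := rfl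

theorem run_append (m : ℕ) (u w) (ξ : State) :
    run m (u ++ w) ξ = run m w (run m u ξ) := by
  simp [run]

theorem wf_run {m : ℕ} (hm : 2 ≤ m) (w) {ξ : State} (h : WF m ξ) : WF m (run m w ξ) := by
  induction w generalizing ξ with
  | nil => exact h
  | cons s w ih => exact ih (wf_act hm s h)

/-- The alternating positive word of length `n` starting with `z`. -/
def altWord : Bool → ℕ → List (Bool × Bool)
  | _, 0 => []
  | z, n + 1 => (z, true) :: altWord (!z) n

theorem run_altWord_top {m : ℕ} (d : ℤ) (l : List ℕ) (j v : ℕ) (e : Bool) (h : v + j < m) :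
    run m (altWord (!e) j) (top d v l e) = top d (v + j) l (not^[j] e) := by
  induction j generalizing v e with
  | zero => rfl
  | succ j ih =>
    have h1 : v + 1 < m := by omega
    have := ih (v + 1) (!e) (by omega)
    simp only [altWord, run_cons, act, Bool.not_eq_eq_eq_not, Bool.eq_not_self,
      h1, if_true, if_false, this, Function.iterate_succ_apply]
    congr 1
    omega

theorem run_altWord_pop {m : ℕ} (d : ℤ) (l : List ℕ) (j v : ℕ) (e : Bool) (h : v + j + 1 = m) :
    run m (altWord (!e) (j + 1)) (top d v l e) = ofList (d + 1) l (not^[j] e) := by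
  induction j generalizing v e with
  | zero =>
    have : ¬ v + 1 < m := by omega
    simp [altWord, act, this]
  | succ j ih =>
    have h1 : v + 1 < m := by omega
    have := ih (v + 1) (!e) (by omega)
    rw [altWord, run_cons]
    simp only [act, Bool.not_eq_eq_eq_not, Bool.eq_not_self, h1, if_true, if_false, this,
      Function.iterate_succ_apply]

theorem run_altWord_append (m : ℕ) (z : Bool) (i j : ℕ) (ξ : State) :
    run m (altWord z (i + j)) ξ = run m (altWord (not^[i] z) j) (run m (altWord z i) ξ) := by
  induction i generalizing z ξ with
  | zero => simp [altWord]
  | succ i ih =>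
    rw [show i + 1 + j = (i + j) + 1 by omega, altWord, run_cons, ih, altWord, run_cons,
      Function.iterate_succ_apply]

theorem iterate_not_add_two (n : ℕ) (e : Bool) : not^[n + 2] e = not^[n] e := by
  simp [Function.iterate_succ_apply]

theorem act_pos_ofList (m : ℕ) (d : ℤ) (l : List ℕ) (e : Bool) :
    act m (e, true) (ofList d l e) = top d 1 l e := by
  cases l <;> simp [ofList, act]

theorem run_altWord_ofList {m : ℕ} (d : ℤ) (l : List ℕ) (j : ℕ) (e : Bool) (h : j + 1 < m) :
    run m (altWord e (j + 1)) (ofList d l e) = top d (j + 1) l (not^[j] e) := by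
  rw [altWord, run_cons, act_pos_ofList, run_altWord_top _ _ _ _ _ (by omega), add_comm]

theorem run_altWord_ofList_full {m : ℕ} (d : ℤ) (l : List ℕ) (e : Bool) (hm : 2 ≤ m) :
    run m (altWord e m) (ofList d l e) = ofList (d + 1) l (not^[m] e) := by
  obtain ⟨n, rfl⟩ : ∃ n, m = n + 2 := ⟨m - 2, by omega⟩
  rw [altWord, run_cons, act_pos_ofList, run_altWord_pop _ _ _ _ _ (by omega),
    iterate_not_add_two]

theorem braid {m : ℕ} (hm : 2 ≤ m) {ξ : State} (h : WF m ξ) (z z' : Bool) :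
    run m (altWord z m) ξ = run m (altWord z' m) ξ := by
  cases ξ with
  | base d =>
    have := fun e => run_altWord_ofList_full d [] e hm
    simp only [ofList] at this
    rw [this, this]
  | top d v l e =>
    have hv : 1 ≤ v ∧ v < m := h v List.mem_cons_self
    have key : run m (altWord (!e) m) (top d v l e) = run m (altWord e m) (top d v l e) := by
      have h1 := run_altWord_ofList_full d (v :: l) e hm
      simp only [ofList] at h1
      rw [h1]
      obtain ⟨i, rfl⟩ : ∃ i, m = v + i + 1 := ⟨m - v - 1, by omega⟩
      obtain ⟨j, rfl⟩ : ∃ j, v = j + 1 := ⟨v - 1, by omega⟩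
      rw [show j + 1 + i + 1 = (i + 1) + (j + 1) by omega, run_altWord_append,
        run_altWord_pop _ _ _ _ _ (by omega), Function.iterate_succ_apply, Bool.not_not,
        run_altWord_ofList _ _ _ _ (by omega), ← Function.iterate_add_apply,
        show i + 1 + (j + 1) = (j + i) + 2 by omega, iterate_not_add_two]
    cases z <;> cases z' <;> cases e <;> simp_all

/-- Exchange of the two generators. -/
def swap : State → State
  | base d => base d
  | top d v l e => top d v l (!e)

theorem act_swap (m : ℕ) (z ε : Bool) (ξ : State) :
    act m (!z, ε) (swap ξ) = swap (act m (z, ε) ξ) := by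
  cases ξ with
  | base d => cases ε <;> rfl
  | top d v l e =>
    cases ε <;> cases z <;> cases e <;> simp [swap, act] <;> (try split_ifs) <;>
      cases l <;> rfl

theorem run_swap (m : ℕ) (w : List (Bool × Bool)) (ξ : State) :
    run m (w.map fun s => (!s.1, s.2)) (swap ξ) = swap (run m w ξ) := by
  induction w generalizing ξ with
  | nil => rfl
  | cons s w ih => rw [List.map_cons, run_cons, run_cons, act_swap, ih]

end Dihedral

namespace Dihedral

open State

theorem iterate_not_add_self (n : ℕ) (e : Bool) : not^[n + n] e = e := by
  rw [← two_mul, Function.iterate_mul, show not^[2] = id from funext fun z => by simp]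
  simp

theorem iterate_not_add_succ (n : ℕ) (e : Bool) : not^[n + (n + 1)] e = !e := by
  rw [← add_assoc, Function.iterate_succ_apply', iterate_not_add_self]

section Eval

variable {G : Type*} [Group G]

/-- The alternating product of length `n` starting with `f z`. -/
def altG (f : Bool → G) : Bool → ℕ → G
  | _, 0 => 1
  | z, n + 1 => f z * altG f (!z) n

theorem altG_succ (f : Bool → G) (z : Bool) (n : ℕ) :
    altG f z (n + 1) = altG f z n * f (not^[n] z) := by
  induction n generalizing z with
  | zero => simp [altG]
  | succ n ih =>
    rw [altG, ih, altG, Function.iterate_succ_apply, mul_assoc]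

theorem altG_mul_altG {f : Bool → G} {m : ℕ} (hf : ∀ z z', altG f z m = altG f z' m)
    (z : Bool) (n : ℕ) :
    altG f z n * altG f true m = altG f true m * altG f (not^[m] z) n := by
  have h1 : ∀ z, f z * altG f true m = altG f true m * f (not^[m] z) := fun z => by
    rw [hf true (!z), hf (!z) z, ← altG_succ, altG, hf z (!z)]
  induction n generalizing z with
  | zero => simp [altG]
  | succ n ih =>
    have h2 : not^[m] (!z) = !(not^[m] z) := by
      rw [← Function.iterate_succ_apply not, ← Function.iterate_succ_apply' not]
    rw [altG, altG, mul_assoc, ih, ← mul_assoc, h1, mul_assoc, h2]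

/-- The element represented by a normal form. -/
def evalList (f : Bool → G) (m : ℕ) (d : ℤ) : List ℕ → Bool → G
  | [], _ => altG f true m ^ d
  | v :: l, e => evalList f m d l (not^[v + 1] e) * altG f (not^[v + 1] e) v

/-- The element represented by a state. -/
def evalState (f : Bool → G) (m : ℕ) : State → G
  | base d => altG f true m ^ d
  | top d v l e => evalList f m d (v :: l) e

theorem evalState_ofList (f : Bool → G) (m : ℕ) (d : ℤ) (l : List ℕ) (e : Bool) :
    evalState f m (ofList d l e) = evalList f m d l e := by
  cases l <;> rfl

theorem evalList_mul {f : Bool → G} {m : ℕ} (hf : ∀ z z', altG f z m = altG f z' m)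
    (d : ℤ) (l : List ℕ) (e : Bool) :
    evalList f m d l e * altG f true m = evalList f m (d + 1) l (not^[m] e) := by
  induction l generalizing e with
  | nil => rw [evalList, evalList, zpow_add_one]
  | cons v l ih =>
    rw [evalList, evalList, mul_assoc, altG_mul_altG hf, ← mul_assoc, ih,
      ← Function.iterate_add_apply, ← Function.iterate_add_apply, add_comm m]

theorem evalState_act_pos {f : Bool → G} {m : ℕ} (hm : 2 ≤ m)
    (hf : ∀ z z', altG f z m = altG f z' m) (z : Bool) {ξ : State} (h : WF m ξ) :
    evalState f m (act m (z, true) ξ) = evalState f m ξ * f z := by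
  cases ξ with
  | base d => simp [act, evalState, evalList, altG]
  | top d v l e =>
    have hv : 1 ≤ v ∧ v < m := h v List.mem_cons_self
    simp only [act]
    split_ifs with h1 h2
    · subst h1
      simp [evalState, evalList, altG]
    · obtain rfl : z = !e := by cases z <;> cases e <;> simp_all
      simp only [evalState, evalList]
      rw [← Function.iterate_succ_apply, show (v + 1 + 1).succ = (v + 1) + 2 by omega,
        iterate_not_add_two, altG_succ, ← Function.iterate_add_apply,
        iterate_not_add_succ, mul_assoc]
    · obtain rfl : z = !e := by cases z <;> cases e <;> simp_all
      obtain rfl : m = v + 1 := by omega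
      rw [evalState_ofList]
      simp only [evalState, evalList]
      have := altG_succ f (not^[v + 1] e) v
      rw [← Function.iterate_add_apply,
        iterate_not_add_succ, hf _ true] at this
      rw [mul_assoc, ← this, evalList_mul hf, ← Function.iterate_add_apply, iterate_not_add_self]

theorem evalState_run {f : Bool → G} {m : ℕ} (hm : 2 ≤ m)
    (hf : ∀ z z', altG f z m = altG f z' m) (w : Word Bool) {ξ : State} (h : WF m ξ) :
    evalState f m (run m w ξ) = evalState f m ξ * evalWord f w := by
  induction w generalizing ξ with
  | nil => simp [evalWord]
  | cons s w ih =>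
    rw [run_cons, ih (wf_act hm s h)]
    have : evalState f m (act m s ξ) = evalState f m ξ * if s.2 then f s.1 else (f s.1)⁻¹ := by
      obtain ⟨z, _ | _⟩ := s
      · have h1 := evalState_act_pos hm hf z (wf_act hm (z, false) h)
        rw [show ((z, true) : Bool × Bool) = inv (z, false) from rfl, act_inv_act hm _ h] at h1
        rw [h1]
        simp
      · simpa using evalState_act_pos hm hf z h
    rw [this]
    simp [evalWord, mul_assoc]

end Eval

theorem evalWord_eq_of_run_eq {G : Type*} [Group G] {f : Bool → G} {m : ℕ} (hm : 2 ≤ m)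
    (hf : ∀ z z', altG f z m = altG f z' m) {w w' : Word Bool}
    (h : run m w (base 0) = run m w' (base 0)) : evalWord f w = evalWord f w' := by
  have h1 := evalState_run hm hf w (ξ := base 0) trivial
  have h2 := evalState_run hm hf w' (ξ := base 0) trivial
  rw [h, h2] at h1
  simpa using h1.symm

/-- Right multiplication by a letter as a permutation of the normal forms. -/
def actPerm {m : ℕ} (hm : 2 ≤ m) (s : Bool × Bool) : Equiv.Perm {ξ : State // WF m ξ} where
  toFun ξ := ⟨act m s ξ, wf_act hm s ξ.2⟩
  invFun ξ := ⟨act m (inv s) ξ, wf_act hm (inv s) ξ.2⟩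
  left_inv ξ := Subtype.ext (act_inv_act hm s ξ.2)
  right_inv ξ := Subtype.ext (act_act_inv hm s ξ.2)

theorem run_eq_of_run_base_eq {m : ℕ} (hm : 2 ≤ m) {w w' : Word Bool}
    (h : run m w (base 0) = run m w' (base 0)) {ξ : State} (hξ : WF m ξ) :
    run m w ξ = run m w' ξ := by
  let f : Bool → (Equiv.Perm {ξ : State // WF m ξ})ᵐᵒᵖ := fun z =>
    MulOpposite.op (actPerm hm (z, true))
  have halt : ∀ n z ξ, ((altG f z n).unop ξ : State) = run m (altWord z n) ξ := by
    intro n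
    induction n with
    | zero => intro z ξ; rfl
    | succ n ih =>
      intro z ξ
      rw [altG, altWord, run_cons, MulOpposite.unop_mul, Equiv.Perm.mul_apply, ih]
      rfl
  have hf : ∀ z z', altG f z m = altG f z' m := fun z z' => by
    apply MulOpposite.unop_injective
    ext1 ξ
    apply Subtype.ext
    rw [halt, halt, braid hm ξ.2 z z']
  have hrun : ∀ (w : Word Bool) ξ, ((evalWord f w).unop ξ : State) = run m w ξ := by
    intro w
    induction w with
    | nil => intro ξ; rfl
    | cons s w ih =>
      intro ξ
      rw [run_cons]
      have : evalWord f (s :: w) = (if s.2 then f s.1 else (f s.1)⁻¹) * evalWord f w := by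
        simp [evalWord]
      rw [this, MulOpposite.unop_mul, Equiv.Perm.mul_apply, ih]
      obtain ⟨z, _ | _⟩ := s <;> rfl
  have := evalWord_eq_of_run_eq hm hf h
  rw [← hrun w ⟨ξ, hξ⟩, ← hrun w' ⟨ξ, hξ⟩, this]

end Dihedral

namespace Dihedral

open State

/-- The exponent of a normal form at level `t`: a factor of length `v` contributes to the
levels below `v`, and `Δ` contributes to every level. -/
def expo : State → ℕ → ℤ
  | base d, _ => d
  | top d v l _, t => d + ((v :: l).countP (t < ·) : ℕ)

/-- The level whose exponent changes under multiplication by a letter. -/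
def idx (m : ℕ) : Bool × Bool → State → ℕ
  | (_, true), base _ => 0
  | (_, false), base _ => m - 1
  | (z, true), top _ v _ e => if z = e then 0 else v
  | (z, false), top _ v _ e => if z = e then v - 1 else m - 1

/-- The sign of a letter. -/
def sgn : Bool → ℤ
  | true => 1
  | false => -1

theorem idx_lt {m : ℕ} (hm : 2 ≤ m) (s : Bool × Bool) {ξ : State} (h : WF m ξ) :
    idx m s ξ < m := by
  obtain ⟨z, ε⟩ := s
  cases ξ with
  | base d => cases ε <;> simp [idx] <;> omega
  | top d v l e =>
    have hv : 1 ≤ v ∧ v < m := h v List.mem_cons_self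
    cases ε <;> simp only [idx] <;> split_ifs <;> omega

theorem expo_ofList (d : ℤ) (l : List ℕ) (e : Bool) (t : ℕ) :
    expo (ofList d l e) t = d + (l.countP (t < ·) : ℕ) := by
  cases l <;> simp [ofList, expo]

theorem expo_act {m : ℕ} (hm : 2 ≤ m) (s : Bool × Bool) {ξ : State} (h : WF m ξ) {t : ℕ}
    (ht : t < m) :
    expo (act m s ξ) t = expo ξ t + if t = idx m s ξ then sgn s.2 else 0 := by
  obtain ⟨z, ε⟩ := s
  cases ξ with
  | base d =>
    cases ε <;> simp only [act, idx, expo, sgn, List.countP_cons, List.countP_nil,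
      decide_eq_true_eq] <;> (repeat' split) <;> push_cast <;> omega
  | top d v l e =>
    have hv : 1 ≤ v ∧ v < m := h v List.mem_cons_self
    cases ε <;> simp only [act, idx] <;> split_ifs <;>
      (try rw [expo_ofList]) <;> simp only [expo, sgn, List.countP_cons, decide_eq_true_eq] <;>
      (repeat' split) <;> push_cast <;> omega

theorem expo_antitone (ξ : State) {t t' : ℕ} (h : t ≤ t') : expo ξ t' ≤ expo ξ t := by
  cases ξ with
  | base d => exact le_rfl
  | top d v l e =>
    have := List.countP_mono_left (l := v :: l) (p := (t' < ·)) (q := (t < ·))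
      (fun x _ hx => by simp at hx ⊢; omega)
    simp only [expo]
    omega

theorem expo_succ_lt {d : ℤ} {v : ℕ} {l : List ℕ} {e : Bool} (hv : 1 ≤ v) :
    expo (top d v l e) v + 1 ≤ expo (top d v l e) (v - 1) := by
  have := List.countP_mono_left (l := l) (p := (v < ·)) (q := (v - 1 < ·))
      (fun x _ hx => by simp at hx ⊢; omega)
  simp only [expo, List.countP_cons, decide_eq_true_eq]
  rw [if_neg (lt_irrefl v), if_pos (by omega)]
  push_cast
  omega

/-- The length of an element of the dihedral Artin group. -/
def len (m : ℕ) (ξ : State) : ℤ := ∑ t ∈ Finset.range m, |expo ξ t|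

/-- The number of levels with nonzero exponent. -/
def levels (m : ℕ) (ξ : State) : ℕ := ((Finset.range m).filter fun t => expo ξ t ≠ 0).card

theorem len_act {m : ℕ} (hm : 2 ≤ m) (s : Bool × Bool) {ξ : State} (h : WF m ξ) :
    len m (act m s ξ) =
      len m ξ + (|expo ξ (idx m s ξ) + sgn s.2| - |expo ξ (idx m s ξ)|) := by
  have hi := Finset.mem_range.2 (idx_lt hm s h)
  rw [len, len, ← Finset.add_sum_erase _ _ hi, ← Finset.add_sum_erase _ _ hi,
    expo_act hm s h (idx_lt hm s h), if_pos rfl]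
  have : ∑ t ∈ (Finset.range m).erase (idx m s ξ), |expo (act m s ξ) t|
      = ∑ t ∈ (Finset.range m).erase (idx m s ξ), |expo ξ t| := by
    refine Finset.sum_congr rfl fun t ht => ?_
    rw [Finset.mem_erase, Finset.mem_range] at ht
    rw [expo_act hm s h ht.2, if_neg ht.1, add_zero]
  rw [this]
  ring

/-- The letter `s` is the last letter of some geodesic word for `ξ`. -/
def Desc (m : ℕ) (ξ : State) (s : Bool × Bool) : Prop := len m (act m (inv s) ξ) < len m ξ

theorem desc_pos_iff {m : ℕ} (hm : 2 ≤ m) (z : Bool) {ξ : State} (h : WF m ξ) :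
    Desc m ξ (z, true) ↔ 0 < expo ξ (idx m (z, false) ξ) := by
  rw [Desc, len_act hm _ h]
  simp only [inv, sgn, Bool.not_true]
  grind

theorem desc_neg_iff {m : ℕ} (hm : 2 ≤ m) (z : Bool) {ξ : State} (h : WF m ξ) :
    Desc m ξ (z, false) ↔ expo ξ (idx m (z, true) ξ) < 0 := by
  rw [Desc, len_act hm _ h]
  simp only [inv, sgn, Bool.not_false]
  grind

theorem len_act_cases {m : ℕ} (hm : 2 ≤ m) (s : Bool × Bool) {ξ : State} (h : WF m ξ) :
    (Desc m ξ (inv s) ∧ len m (act m s ξ) = len m ξ - 1) ∨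
      (¬ Desc m ξ (inv s) ∧ len m (act m s ξ) = len m ξ + 1) := by
  rw [Desc, inv_inv, len_act hm _ h]
  obtain ⟨z, _ | _⟩ := s <;> simp only [sgn] <;> grind

theorem not_desc_desc_inv {m : ℕ} (hm : 2 ≤ m) {s : Bool × Bool} {ξ : State} (h : WF m ξ)
    (h1 : Desc m ξ s) (h2 : Desc m ξ (inv s)) : False := by
  wlog hs : s.2 = true generalizing s
  · exact this h2 (by simpa using h1) (by simpa [inv] using hs)
  obtain ⟨z, ε⟩ := s
  obtain rfl : ε = true := hs
  have h2 : Desc m ξ (z, false) := h2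
  rw [desc_pos_iff hm z h] at h1
  rw [desc_neg_iff hm z h] at h2
  cases ξ with
  | base d => simp only [expo] at h1 h2; omega
  | top d v l e =>
    have hv : 1 ≤ v ∧ v < m := h v List.mem_cons_self
    have : idx m (z, true) (top d v l e) ≤ idx m (z, false) (top d v l e) := by
      simp only [idx]; split_ifs <;> omega
    have := expo_antitone (top d v l e) this
    omega

theorem len_nonneg (m : ℕ) (ξ : State) : 0 ≤ len m ξ := Finset.sum_nonneg fun _ _ => abs_nonneg _

theorem len_base_zero (m : ℕ) : len m (base 0) = 0 := by simp [len, expo]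

theorem exists_desc {m : ℕ} (hm : 2 ≤ m) {ξ : State} (h : WF m ξ) (h0 : ξ ≠ base 0) :
    ∃ s, Desc m ξ s := by
  cases ξ with
  | base d =>
    rcases lt_trichotomy d 0 with hd | rfl | hd
    · exact ⟨(true, false), (desc_neg_iff hm _ h).2 hd⟩
    · exact absurd rfl h0
    · exact ⟨(true, true), (desc_pos_iff hm _ h).2 hd⟩
  | top d v l e =>
    have hv : 1 ≤ v ∧ v < m := h v List.mem_cons_self
    have := expo_succ_lt (d := d) (l := l) (e := e) hv.1
    by_cases hp : 0 < expo (top d v l e) (v - 1)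
    · exact ⟨(e, true), (desc_pos_iff hm _ h).2 (by simpa [idx] using hp)⟩
    · exact ⟨(!e, false), (desc_neg_iff hm _ h).2 (by simp [idx]; omega)⟩

theorem levels_act_le {m : ℕ} (hm : 2 ≤ m) (s : Bool × Bool) {ξ : State} (h : WF m ξ) :
    levels m (act m s ξ) ≤ levels m ξ + 1 := by
  refine le_trans (Finset.card_le_card (t := insert (idx m s ξ) _) fun t ht => ?_)
    (Finset.card_insert_le _ _)
  rw [Finset.mem_filter, Finset.mem_range] at ht
  rw [Finset.mem_insert, Finset.mem_filter, Finset.mem_range]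
  by_cases hi : t = idx m s ξ
  · exact Or.inl hi
  · have := ht.2
    rw [expo_act hm s h ht.1, if_neg hi, add_zero] at this
    exact Or.inr ⟨ht.1, this⟩

theorem levels_act_le_of_desc {m : ℕ} (hm : 2 ≤ m) (s : Bool × Bool) {ξ : State} (h : WF m ξ)
    (hs : Desc m ξ s) : levels m (act m s ξ) ≤ levels m ξ := by
  refine Finset.card_le_card fun t ht => ?_
  rw [Finset.mem_filter, Finset.mem_range] at ht ⊢
  refine ⟨ht.1, ?_⟩
  by_cases hi : t = idx m s ξ
  · subst hi
    obtain ⟨z, _ | _⟩ := s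
    · rw [desc_neg_iff hm z h] at hs
      have : idx m (z, true) ξ ≤ idx m (z, false) ξ := by
        cases ξ with
        | base d => simp only [idx]; omega
        | top d v l e =>
          have hv : 1 ≤ v ∧ v < m := h v List.mem_cons_self
          simp only [idx]; split_ifs <;> omega
      have := expo_antitone ξ this
      omega
    · rw [desc_pos_iff hm z h] at hs
      have : idx m (z, true) ξ ≤ idx m (z, false) ξ := by
        cases ξ with
        | base d => simp only [idx]; omega
        | top d v l e =>
          have hv : 1 ≤ v ∧ v < m := h v List.mem_cons_self
          simp only [idx]; split_ifs <;> omega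
      have := expo_antitone ξ this
      omega
  · have := ht.2
    rwa [expo_act hm s h ht.1, if_neg hi, add_zero] at this

end Dihedral

namespace Dihedral

open State

theorem levels_eq_of_desc {m : ℕ} (hm : 2 ≤ m) {s t : Bool × Bool} {ξ : State} (h : WF m ξ)
    (hs : Desc m ξ s) (ht : Desc m ξ t) (hst : s.1 ≠ t.1) : levels m ξ = m := by
  have key : ∀ i < m, expo ξ i ≠ 0 := by
    intro i hi
    have h0 := expo_antitone ξ (Nat.zero_le i)
    have h1 := expo_antitone ξ (show i ≤ m - 1 by omega)
    obtain ⟨z, ε⟩ := s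
    obtain ⟨z', ε'⟩ := t
    obtain rfl : z' = !z := by cases z <;> cases z' <;> simp_all
    cases ξ with
    | base d =>
      cases ε
      · rw [desc_neg_iff hm _ h] at hs; simp only [expo] at *; omega
      · rw [desc_pos_iff hm _ h] at hs; simp only [expo] at *; omega
    | top d v l e =>
      have hv : 1 ≤ v ∧ v < m := h v List.mem_cons_self
      have h2 : i ≤ v - 1 ∨ v ≤ i := by omega
      have h3 := h2.imp (expo_antitone (top d v l e)) (expo_antitone (top d v l e))
      cases ε <;> cases ε' <;>
        simp only [desc_neg_iff hm _ h, desc_pos_iff hm _ h, idx] at hs ht <;>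
        cases z <;> cases e <;> simp at hs ht <;> omega
  rw [levels, Finset.filter_true_of_mem fun i hi => key i (Finset.mem_range.1 hi),
    Finset.card_range]

section OfList

variable {m : ℕ} (hm : 2 ≤ m) {d : ℤ} {l : List ℕ} {e : Bool} (h : ∀ u ∈ l, 1 ≤ u ∧ u < m)
include hm h

theorem desc_ofList_not_pos (hp : 0 < expo (ofList d l e) (m - 1)) :
    Desc m (ofList d l e) (!e, true) := by
  rw [desc_pos_iff hm _ (wf_ofList h)]
  cases l with
  | nil => exact hp
  | cons v l => simpa [ofList, idx] using hp

theorem desc_ofList_neg (hp : expo (ofList d l e) 0 < 0) :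
    Desc m (ofList d l e) (e, false) := by
  rw [desc_neg_iff hm _ (wf_ofList h)]
  cases l with
  | nil => exact hp
  | cons v l => simpa [ofList, idx] using hp

theorem desc_ofList_not_neg (hp : expo (ofList d l e) 1 < 0) :
    Desc m (ofList d l e) (!e, false) := by
  rw [desc_neg_iff hm _ (wf_ofList h)]
  cases l with
  | nil => exact hp
  | cons v l =>
    have := expo_antitone (top d v l e) (h v List.mem_cons_self).1
    simp only [ofList] at hp
    simp [ofList, idx]
    omega

theorem desc_ofList_pos (hp : 0 < expo (ofList d l e) (m - 2)) :
    Desc m (ofList d l e) (e, true) := by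
  rw [desc_pos_iff hm _ (wf_ofList h)]
  cases l with
  | nil => exact hp
  | cons v l =>
    have := expo_antitone (top d v l e)
      (show v - 1 ≤ m - 2 by have := h v List.mem_cons_self; omega)
    simp only [ofList] at hp
    simp [ofList, idx]
    omega

end OfList

theorem exists_desc_of_desc {m : ℕ} (hm : 2 ≤ m) {s t : Bool × Bool} {ξ : State} (h : WF m ξ)
    (hs : Desc m ξ s) (ht : Desc m ξ t) (hst : s.1 ≠ t.1) :
    ∃ r, r.1 = t.1 ∧ Desc m (act m (inv s) ξ) r := by
  suffices H : Desc m (act m (inv s) ξ) (t.1, true) ∨ Desc m (act m (inv s) ξ) (t.1, false) by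
    rcases H with H | H
    exacts [⟨(t.1, true), rfl, H⟩, ⟨(t.1, false), rfl, H⟩]
  have hw := wf_act hm (inv s) h
  have hN := fun i hi => expo_act hm (inv s) h (t := i) hi
  obtain ⟨z, ε⟩ := s
  obtain ⟨z', ε'⟩ := t
  obtain rfl : z' = !z := by cases z <;> cases z' <;> simp_all
  cases ξ with
  | base d =>
    cases ε
    · rw [desc_neg_iff hm _ h] at hs
      simp only [expo] at hs
      right
      rw [desc_neg_iff hm _ hw]
      simp [inv, act, idx, expo]
      omega
    · rw [desc_pos_iff hm _ h] at hs
      simp only [expo] at hs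
      left
      rw [desc_pos_iff hm _ hw]
      have : m - 1 - 1 < m - 1 := by omega
      simp [inv, act, idx, expo, this]
      omega
  | top d v l e =>
    have hv : 1 ≤ v ∧ v < m := h v List.mem_cons_self
    have hl : ∀ u ∈ l, 1 ≤ u ∧ u < m := fun u hu => h u (List.mem_cons_of_mem _ hu)
    have a0 := fun i => expo_antitone (top d v l e) (Nat.zero_le i)
    have a1 := fun i (hi : i < m) => expo_antitone (top d v l e) (show i ≤ m - 1 by omega)
    have a2 := fun i (hi : i ≤ v - 1) => expo_antitone (top d v l e) hi
    have a3 := fun i (hi : v ≤ i) => expo_antitone (top d v l e) hi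
    have hee : (!e) ≠ e := by cases e <;> simp
    by_cases hz : z = e
    · subst hz
      cases ε
      · rw [desc_neg_iff hm _ h] at hs
        right
        rw [desc_neg_iff hm _ hw]
        have h1 := hN 1 (by omega)
        simp [inv, act, idx] at hs h1 ⊢
        have := a0 1
        omega
      · rw [desc_pos_iff hm _ h] at hs
        by_cases hv1 : v = 1
        · subst hv1
          simp only [inv, act, idx, if_true, Bool.not_true, Nat.sub_self] at hs hN ⊢
          cases ε'
          · rw [desc_neg_iff hm _ h] at ht
            have h1 := hN 1 (by omega)
            simp [idx] at ht h1
            exact Or.inr (desc_ofList_not_neg hm hl (by omega))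
          · rw [desc_pos_iff hm _ h] at ht
            have h1 := hN (m - 1) (by omega)
            rw [if_neg (by omega)] at h1
            simp [idx] at ht
            exact Or.inl (desc_ofList_not_pos hm hl (by omega))
        · left
          rw [desc_pos_iff hm _ hw]
          have h1 := hN (v - 2) (by omega)
          have h2 := a2 (v - 2) (by omega)
          have h3 : v - 2 ≠ v - 1 := by omega
          have h4 : v - 1 - 1 = v - 2 := by omega
          simp [inv, act, idx, hv1, h3, h4] at hs h1 ⊢
          omega
    · obtain rfl : z = !e := by cases z <;> cases e <;> simp_all
      cases ε
      · rw [desc_neg_iff hm _ h] at hs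
        by_cases hv1 : v + 1 < m
        · right
          rw [desc_neg_iff hm _ hw]
          have h1 := hN (v + 1) (by omega)
          have h2 := a3 (v + 1) (by omega)
          simp [inv, act, idx, hv1] at hs h1 ⊢
          omega
        · obtain rfl : m = v + 1 := by omega
          simp [inv, act, idx] at hs hN ht ⊢
          cases ε'
          · rw [desc_neg_iff hm _ h] at ht
            have h1 := hN 0 (by omega)
            rw [if_neg (by omega)] at h1
            simp [idx] at ht
            exact Or.inr (desc_ofList_neg hm hl (by omega))
          · rw [desc_pos_iff hm _ h] at ht
            have h1 := hN (v + 1 - 2) (by omega)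
            rw [if_neg (by omega)] at h1
            simp [idx] at ht
            exact Or.inl (desc_ofList_pos hm hl (by rw [h1]; simpa using ht))
      · rw [desc_pos_iff hm _ h] at hs
        left
        rw [desc_pos_iff hm _ hw]
        have h1 := hN (m - 1 - 1) (by omega)
        have h2 := a1 (m - 1 - 1) (by omega)
        have h3 : m - 1 - 1 ≠ m - 1 := by omega
        simp [inv, act, idx, h3] at hs h1 ⊢
        omega

end Dihedral

/-- A labelling of the edges of a graph defining a 3-free Artin group. -/
class ThreeFree {X : Type*} (m : X → X → ℕ∞) : Prop where
  symm : ∀ x y, m x y = m y x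
  two_le : ∀ x y, x ≠ y → 2 ≤ m x y
  ne_three : ∀ x y, x ≠ y → m x y ≠ 3

namespace ThreeFree

open Dihedral

variable {X : Type*}

/-- The generators `x ≠ y` are joined by an edge with (finite) label `k`. -/
def Lab (m : X → X → ℕ∞) (x y : X) (k : ℕ) : Prop := x ≠ y ∧ m x y = (k : ℕ∞)

theorem Lab.symm {m : X → X → ℕ∞} [ThreeFree m] {x y : X} {k : ℕ} (h : Lab m x y k) :
    Lab m y x k := ⟨h.1.symm, by rw [ThreeFree.symm (m := m), h.2]⟩

theorem Lab.two_le {m : X → X → ℕ∞} [ThreeFree m] {x y : X} {k : ℕ} (h : Lab m x y k) :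
    2 ≤ k := by
  have := ThreeFree.two_le (m := m) x y h.1
  rw [h.2] at this
  exact_mod_cast this

theorem Lab.unique {m : X → X → ℕ∞} {x y : X} {k k' : ℕ} (h : Lab m x y k) (h' : Lab m x y k') :
    k = k' := by
  have := h.2.symm.trans h'.2
  exact_mod_cast this

/-- All letters of the word `w` are `x`, `y` or their inverses. -/
def Over (x y : X) (w : Word X) : Prop := ∀ p ∈ w, p.1 = x ∨ p.1 = y

open Classical in
/-- A letter with generator `x` or `y` as a letter of the dihedral Artin group. -/
noncomputable def toDi (x : X) (p : X × Bool) : Bool × Bool := (decide (p.1 = x), p.2)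

theorem toDi_inv (x : X) (p : X × Bool) : toDi x (inv p) = inv (toDi x p) := rfl

theorem toDi_fst_ne {x y : X} {s t : X × Bool} (hs : s.1 = x ∨ s.1 = y)
    (ht : t.1 = x ∨ t.1 = y) (hst : s.1 ≠ t.1) : (toDi x s).1 ≠ (toDi x t).1 := by
  simp only [toDi, ne_eq, decide_eq_decide]
  grind

theorem exists_toDi {x y : X} (hxy : x ≠ y) (p : Bool × Bool) :
    ∃ s : X × Bool, (s.1 = x ∨ s.1 = y) ∧ toDi x s = p := by
  obtain ⟨z, ε⟩ := p
  cases z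
  · exact ⟨(y, ε), Or.inr rfl, by simp [toDi, hxy.symm]⟩
  · exact ⟨(x, ε), Or.inl rfl, by simp [toDi]⟩

/-- The normal form of a word over two generators. -/
noncomputable def val (k : ℕ) (x : X) (w : Word X) : State := run k (w.map (toDi x)) (State.base 0)

/-- The word `w` is geodesic in the dihedral Artin group. -/
def Geo (k : ℕ) (x : X) (w : Word X) : Prop := len k (val k x w) = w.length

/-- Two geodesic words in a dihedral Artin group representing the same element and ending in
different generators. -/
def Rel (m : X → X → ℕ∞) (w w' : Word X) : Prop :=
  ∃ (x y : X) (k : ℕ) (u : Word X) (s : X × Bool) (u' : Word X) (t : X × Bool), Lab m x y k ∧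
    w = u ++ [s] ∧ w' = u' ++ [t] ∧ s.1 ≠ t.1 ∧
    Over x y w ∧ Over x y w' ∧ Geo k x w ∧ Geo k x w' ∧ val k x w = val k x w'

/-- The monoid of words modulo the length-preserving dihedral relations. -/
abbrev M (m : X → X → ℕ∞) : Type _ :=
  (conGen fun a b : FreeMonoid (X × Bool) => Rel m a.toList b.toList).Quotient

variable {m : X → X → ℕ∞}

variable (m) in
/-- The class of a word. -/
def cl (w : Word X) : M m := ((FreeMonoid.ofList w : FreeMonoid (X × Bool)) : M m)

variable (m) in
/-- The class of a letter. -/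
def g (s : X × Bool) : M m := cl m [s]

@[simp] theorem cl_nil : cl m ([] : Word X) = 1 := rfl

theorem cl_append (u w : Word X) : cl m (u ++ w) = cl m u * cl m w := rfl

theorem cl_surj (c : M m) : ∃ w, cl m w = c := by
  induction c using Con.induction_on with
  | H w => exact ⟨w.toList, rfl⟩

theorem cl_eq_of_rel {w w' : Word X} (h : Rel m w w') : cl m w = cl m w' :=
  (Con.eq _).2 (ConGen.Rel.of _ _ h)

theorem cl_induction {P : Word X → Word X → Prop} (of : ∀ w w', Rel m w w' → P w w')
    (refl : ∀ w, P w w) (symm : ∀ w w', P w w' → P w' w)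
    (trans : ∀ w w' w'', P w w' → P w' w'' → P w w'')
    (mul : ∀ u u' v v', P u u' → P v v' → P (u ++ v) (u' ++ v')) {w w' : Word X}
    (h : cl m w = cl m w') : P w w' := by
  have h := (Con.eq _).1 h
  have : ∀ a b : FreeMonoid (X × Bool), ConGen.Rel (fun a b => Rel m a.toList b.toList) a b →
      P a.toList b.toList := by
    intro a b hab
    induction hab with
    | of _ _ h => exact of _ _ h
    | refl => exact refl _
    | symm _ h => exact symm _ _ h
    | trans _ _ h1 h2 => exact trans _ _ _ h1 h2
    | mul _ _ h1 h2 => exact mul _ _ _ _ h1 h2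
  exact this _ _ h

theorem Rel.symm {w w' : Word X} (h : Rel m w w') : Rel m w' w := by
  obtain ⟨x, y, k, u, s, u', t, h1, h2, h3, h4, h5, h6, h7, h8, h9⟩ := h
  exact ⟨x, y, k, u', t, u, s, h1, h3, h2, h4.symm, h6, h5, h8, h7, h9.symm⟩

theorem Rel.length_eq {w w' : Word X} (h : Rel m w w') : w.length = w'.length := by
  obtain ⟨x, y, k, u, s, u', t, h1, h2, h3, h4, h5, h6, h7, h8, h9⟩ := h
  rw [Geo] at h7 h8
  rw [h9, h8] at h7
  exact_mod_cast h7.symm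

theorem length_eq_of_cl_eq {w w' : Word X} (h : cl m w = cl m w') : w.length = w'.length := by
  refine cl_induction (P := fun w w' => w.length = w'.length) (fun _ _ h => h.length_eq)
    (fun _ => rfl) (fun _ _ h => h.symm) (fun _ _ _ h1 h2 => h1.trans h2)
    (fun _ _ _ _ h1 h2 => by simp [h1, h2]) h

/-- The generators occurring in a word. -/
def names (w : Word X) : Set X := {x | ∃ p ∈ w, p.1 = x}

@[simp] theorem names_append (u w : Word X) : names (u ++ w) = names u ∪ names w := by
  ext x
  simp only [names, Set.mem_ofPred_eq, Set.mem_union, List.mem_append]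
  grind

@[simp] theorem names_nil : names ([] : Word X) = ∅ := by simp [names]

@[simp] theorem names_singleton (s : X × Bool) : names [s] = {s.1} := by
  ext x; simp [names, eq_comm]

theorem over_iff {x y : X} {w : Word X} : Over x y w ↔ names w ⊆ {x, y} := by
  constructor
  · rintro h _ ⟨p, hp, rfl⟩
    exact h p hp
  · intro h p hp
    exact h ⟨p, hp, rfl⟩

theorem val_append (k : ℕ) (x : X) (u w : Word X) :
    val k x (u ++ w) = run k (w.map (toDi x)) (val k x u) := by
  rw [val, List.map_append, run_append, val]

theorem val_snoc (k : ℕ) (x : X) (u : Word X) (s : X × Bool) :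
    val k x (u ++ [s]) = act k (toDi x s) (val k x u) := by
  rw [val_append]; rfl

theorem wf_val {k : ℕ} (hk : 2 ≤ k) (x : X) (w : Word X) : WF k (val k x w) :=
  wf_run hk _ trivial

theorem len_val_le {k : ℕ} (hk : 2 ≤ k) (x : X) (w : Word X) : len k (val k x w) ≤ w.length := by
  induction w using List.reverseRecOn with
  | nil => exact (len_base_zero k).le
  | append_singleton w s ih =>
    rw [val_snoc, List.length_append, List.length_singleton]
    have := len_act_cases hk (toDi x s) (wf_val hk x w)
    omega

theorem Geo.of_append {k : ℕ} (hk : 2 ≤ k) {x : X} {u w : Word X} (h : Geo k x (u ++ w)) :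
    Geo k x u := by
  induction w using List.reverseRecOn with
  | nil => simpa using h
  | append_singleton w s ih =>
    apply ih
    rw [← List.append_assoc, Geo, val_snoc, List.length_append, List.length_singleton] at h
    have h1 := len_act_cases hk (toDi x s) (wf_val hk x (u ++ w))
    have h2 := len_val_le hk x (u ++ w)
    rw [Geo]
    push_cast at h
    omega

theorem Geo.desc {k : ℕ} (hk : 2 ≤ k) {x : X} {u : Word X} {s : X × Bool}
    (h : Geo k x (u ++ [s])) : Desc k (val k x (u ++ [s])) (toDi x s) := by
  have h1 := len_val_le hk x u
  rw [Desc, val_snoc, act_inv_act hk _ (wf_val hk x u), ← val_snoc, h, List.length_append]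
  simp
  omega

theorem levels_le_of_single {k : ℕ} (hk : 2 ≤ k) {x z : X} {u p : Word X} (hp : names p ⊆ {z})
    (h : Geo k x (u ++ p)) : levels k (val k x (u ++ p)) ≤ levels k (val k x u) + 1 := by
  induction p using List.reverseRecOn with
  | nil => simp
  | append_singleton p s ih =>
    rw [names_append, Set.union_subset_iff, names_singleton, Set.singleton_subset_iff,
      Set.mem_singleton_iff] at hp
    rw [← List.append_assoc] at h ⊢
    rw [val_snoc]
    rcases List.eq_nil_or_concat p with rfl | ⟨p', t, rfl⟩
    · rw [List.append_nil]
      exact levels_act_le hk _ (wf_val hk x u)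
    · rw [List.concat_eq_append] at *
      rw [← List.append_assoc] at h ih ⊢
      have ht : t.1 = z := by
        have := hp.1
        rw [names_append, names_singleton] at this
        exact this (Or.inr rfl)
      have h1 := h.of_append hk
      have hd : Desc k (val k x (u ++ p' ++ [t])) (toDi x s) := by
        rcases eq_or_eq_inv (hp.2.trans ht.symm) with rfl | rfl
        · exact h1.desc hk
        · have h2 := h.desc hk
          exfalso
          rw [Desc, val_snoc, ← toDi_inv, inv_inv, toDi_inv, val_snoc k x (u ++ p') t,
            act_inv_act hk _ (wf_val hk x _), ← val_snoc] at h2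
          rw [Geo, val_snoc, val_snoc k x (u ++ p') t, toDi_inv,
            act_inv_act hk _ (wf_val hk x _)] at h
          have := len_val_le hk x (u ++ p')
          simp at h this
          omega
      exact (levels_act_le_of_desc hk _ (wf_val hk x _) hd).trans (ih hp.1 h1)

theorem Rel.names_eq [ThreeFree m] {w w' : Word X} (h : Rel m w w') : names w = names w' := by
  suffices H : ∀ w w' : Word X, Rel m w w' → names w ⊆ names w' from
    (H _ _ h).antisymm (H _ _ h.symm)
  rintro w w' ⟨x, y, k, u, s, u', t, hl, hw, hw', hst, ho, ho', hg, hg', hv⟩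
  suffices H : ∀ z ∈ ({x, y} : Set X), z ∈ names w' from fun z hz => H z (over_iff.1 ho hz)
  have hk := hl.two_le
  by_contra! hcon
  have hsub : ∃ z', names w' ⊆ {z'} := by
    obtain ⟨z, hz, hzw⟩ := hcon
    have h1 := over_iff.1 ho'
    rcases hz with rfl | rfl
    · exact ⟨y, fun q hq => (h1 hq).resolve_left (by rintro rfl; exact hzw hq)⟩
    · exact ⟨x, fun q hq => (h1 hq).resolve_right (by rintro rfl; exact hzw hq)⟩
  obtain ⟨z', hz'⟩ := hsub
  have h1 := levels_le_of_single hk (u := []) hz' hg'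
  have h0 : levels k (val k x []) = 0 := by simp [levels, val, expo]
  have hs : s.1 = x ∨ s.1 = y := ho s (by simp [hw])
  have ht : t.1 = x ∨ t.1 = y := ho' t (by simp [hw'])
  have h2 : levels k (val k x w') = k := by
    refine levels_eq_of_desc hk (wf_val hk x w') (s := toDi x s) (t := toDi x t) ?_ ?_
      (toDi_fst_ne hs ht hst)
    · rw [← hv, hw]
      exact Geo.desc hk (hw ▸ hg)
    · rw [hw']
      exact Geo.desc hk (hw' ▸ hg')
  rw [List.nil_append] at h1
  omega

theorem names_eq_of_cl_eq [ThreeFree m] {w w' : Word X} (h : cl m w = cl m w') :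
    names w = names w' := by
  refine cl_induction (P := fun w w' => names w = names w') (fun _ _ h => h.names_eq)
    (fun _ => rfl) (fun _ _ h => h.symm) (fun _ _ _ h1 h2 => h1.trans h2)
    (fun _ _ _ _ h1 h2 => by simp [h1, h2]) h

end ThreeFree

namespace ThreeFree

open Dihedral

variable {X : Type*} {m : X → X → ℕ∞}

theorem swap_swap (ξ : State) : swap (swap ξ) = ξ := by cases ξ <;> simp [swap]

theorem val_swap {x y : X} (hxy : x ≠ y) (k : ℕ) {w : Word X} (h : Over x y w) :
    val k y w = swap (val k x w) := by
  rw [val, val, ← run_swap, List.map_map]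
  congr 1
  refine List.map_congr_left fun p hp => ?_
  rcases h p hp with h | h <;> simp [toDi, h, hxy, hxy.symm]

theorem run_eq_of_cl_eq [ThreeFree m] {x y : X} {k : ℕ} (hl : Lab m x y k) {w w' : Word X}
    (h : cl m w = cl m w') (ho : Over x y w) {ξ : State} (hξ : WF k ξ) :
    run k (w.map (toDi x)) ξ = run k (w'.map (toDi x)) ξ := by
  have hk := hl.two_le
  suffices H : cl m w = cl m w' ∧ (Over x y w → ∀ ξ, WF k ξ →
      run k (w.map (toDi x)) ξ = run k (w'.map (toDi x)) ξ) from H.2 ho ξ hξ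
  have over_of : ∀ {w w' : Word X}, cl m w = cl m w' → Over x y w → Over x y w' := by
    intro w w' h h'
    rwa [over_iff, ← names_eq_of_cl_eq h, ← over_iff]
  refine cl_induction (P := fun w w' => cl m w = cl m w' ∧ (Over x y w → ∀ ξ, WF k ξ →
    run k (w.map (toDi x)) ξ = run k (w'.map (toDi x)) ξ)) ?_ ?_ ?_ ?_ ?_ h
  · intro w w' hr
    have hr0 := hr
    refine ⟨cl_eq_of_rel hr, fun ho => ?_⟩
    have ho2 := over_of (cl_eq_of_rel hr) ho
    obtain ⟨x', y', k', u, s, u', t, hl', hw, hw', hst, ho', ho'', hg, hg', hv⟩ := hr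
    have hs := ho s (by simp [hw])
    have ht := ho2 t (by simp [hw'])
    have hs' := ho' s (by simp [hw])
    have ht' := ho'' t (by simp [hw'])
    have hcase : (x' = x ∧ y' = y) ∨ (x' = y ∧ y' = x) := by grind
    rcases hcase with ⟨rfl, rfl⟩ | ⟨rfl, rfl⟩
    · obtain rfl := hl.unique hl'
      exact fun ξ hξ => run_eq_of_run_base_eq hk hv hξ
    · obtain rfl := hl.unique hl'.symm
      rw [val_swap hl.1 k ho, val_swap hl.1 k ho2] at hv
      have hv := congrArg swap hv
      rw [swap_swap, swap_swap] at hv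
      exact fun ξ hξ => run_eq_of_run_base_eq hk hv hξ
  · exact fun w => ⟨rfl, fun _ _ _ => rfl⟩
  · exact fun w w' h => ⟨h.1.symm, fun ho ξ hξ => (h.2 (over_of h.1.symm ho) ξ hξ).symm⟩
  · exact fun w w' w'' h h' => ⟨h.1.trans h'.1, fun ho ξ hξ =>
      (h.2 ho ξ hξ).trans (h'.2 (over_of h.1 ho) ξ hξ)⟩
  · intro u u' v v' h h'
    refine ⟨by rw [cl_append, cl_append, h.1, h'.1], fun ho ξ hξ => ?_⟩
    have ho1 : Over x y u := fun p hp => ho p (List.mem_append_left _ hp)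
    have ho2 : Over x y v := fun p hp => ho p (List.mem_append_right _ hp)
    rw [List.map_append, List.map_append, run_append, run_append, h.2 ho1 ξ hξ,
      h'.2 ho2 _ (wf_run hk _ hξ)]

theorem evalWord_append {G : Type*} [Group G] {Y : Type*} (f : Y → G) (u w : Word Y) :
    evalWord f (u ++ w) = evalWord f u * evalWord f w := by
  simp [evalWord]

theorem evalWord_toDi {x y : X} (hxy : x ≠ y) {G : Type*} [Group G] (f : X → G) {w : Word X}
    (h : Over x y w) :
    evalWord f w = evalWord (fun z : Bool => f (if z then x else y)) (w.map (toDi x)) := by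
  simp only [evalWord, List.map_map]
  congr 1
  refine List.map_congr_left fun p hp => ?_
  rcases h p hp with h | h <;> simp [toDi, h, hxy.symm]

theorem altG_eq_mk {x y : X} {G : Type*} [Group G] (φ : FreeGroup X →* G) (n : ℕ) (z : Bool) :
    altG (fun z : Bool => φ (FreeGroup.of (if z then x else y))) z n =
      φ (altProd n (if z then x else y) (if z then y else x)) := by
  induction n generalizing z with
  | zero => simp [altG, altProd]
  | succ n ih =>
    rw [altG, ih, altProd, map_mul]
    cases z <;> simp

theorem evalWord_eq_of_cl_eq [ThreeFree m] {w w' : Word X} (h : cl m w = cl m w') :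
    evalWord (artinGen m) w = evalWord (artinGen m) w' := by
  refine cl_induction (P := fun w w' => evalWord (artinGen m) w = evalWord (artinGen m) w')
    ?_ (fun _ => rfl) (fun _ _ h => h.symm) (fun _ _ _ h1 h2 => h1.trans h2)
    (fun _ _ _ _ h1 h2 => by rw [evalWord_append, evalWord_append, h1, h2]) h
  rintro w w' ⟨x, y, k, u, s, u', t, hl, hw, hw', hst, ho, ho', hg, hg', hv⟩
  rw [evalWord_toDi hl.1 _ ho, evalWord_toDi hl.1 _ ho']
  refine evalWord_eq_of_run_eq hl.two_le ?_ hv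
  have key : altG (fun z : Bool => artinGen m (if z then x else y)) true k =
      altG (fun z : Bool => artinGen m (if z then x else y)) false k := by
    have h1 := fun z => altG_eq_mk (x := x) (y := y) (PresentedGroup.mk (artinRels m)) k z
    change altG (fun z : Bool => PresentedGroup.mk (artinRels m) _) true k = 
      altG (fun z : Bool => PresentedGroup.mk (artinRels m) _) false k
    rw [h1, h1]
    exact PresentedGroup.mk_eq_mk_of_mul_inv_mem ⟨x, y, k, hl.1, hl.2, by simp⟩
  intro z z'
  cases z <;> cases z' <;> first | rfl | exact key | exact key.symm

/-! ### The monoid `M` -/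

/-- The word length on `M`. -/
noncomputable def ln (c : M m) : ℕ := (cl_surj c).choose.length

@[simp] theorem ln_cl (w : Word X) : ln (cl m w) = w.length :=
  length_eq_of_cl_eq (cl_surj (cl m w)).choose_spec

@[simp] theorem ln_mul (a b : M m) : ln (a * b) = ln a + ln b := by
  obtain ⟨u, rfl⟩ := cl_surj a
  obtain ⟨w, rfl⟩ := cl_surj b
  rw [← cl_append]
  simp

@[simp] theorem ln_g (s : X × Bool) : ln (g m s) = 1 := by simp [g]

@[simp] theorem ln_one : ln (1 : M m) = 0 := by
  rw [← cl_nil, ln_cl, List.length_nil]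

theorem eq_one_or (c : M m) : c = 1 ∨ ∃ a s, c = a * g m s := by
  obtain ⟨w, rfl⟩ := cl_surj c
  rcases List.eq_nil_or_concat w with rfl | ⟨u, s, rfl⟩
  · exact Or.inl rfl
  · exact Or.inr ⟨cl m u, s, by rw [List.concat_eq_append, cl_append]; rfl⟩

theorem eq_one_of_ln {c : M m} (h : ln c = 0) : c = 1 := by
  rcases eq_one_or c with h1 | ⟨a, s, rfl⟩
  · exact h1
  · simp at h

theorem M_induction {P : M m → Prop} (one : P 1) (mul : ∀ a s, P a → P (a * g m s)) (c : M m) :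
    P c := by
  obtain ⟨w, rfl⟩ := cl_surj c
  induction w using List.reverseRecOn with
  | nil => exact one
  | append_singleton w s ih => exact mul _ s ih

/-- The generators occurring in an element of `M`. -/
def supp (c : M m) : Set X := names (cl_surj c).choose

section

variable [ThreeFree m]

@[simp] theorem supp_cl (w : Word X) : supp (cl m w) = names w :=
  names_eq_of_cl_eq (cl_surj (cl m w)).choose_spec

@[simp] theorem supp_mul (a b : M m) : supp (a * b) = supp a ∪ supp b := by
  obtain ⟨u, rfl⟩ := cl_surj a
  obtain ⟨w, rfl⟩ := cl_surj b
  rw [← cl_append]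
  simp

@[simp] theorem supp_g (s : X × Bool) : supp (g m s) = {s.1} := by simp [g]

@[simp] theorem supp_one : supp (1 : M m) = ∅ := by
  rw [← cl_nil, supp_cl, names_nil]

end

/-- `c` is reduced: it has no expression containing a letter next to its inverse. -/
def Red (c : M m) : Prop := ∀ a s b, c ≠ a * g m s * g m (inv s) * b

theorem Red.left {a b : M m} (h : Red (a * b)) : Red a := by
  rintro a' s b' rfl
  exact h a' s (b' * b) (by simp only [mul_assoc])

theorem Red.right {a b : M m} (h : Red (a * b)) : Red b := by
  rintro a' s b' rfl
  exact h (a * a') s b' (by simp only [mul_assoc])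

theorem red_one : Red (1 : M m) := by
  intro a s b h
  have := congrArg ln h
  simp only [ln_one, ln_mul, ln_g] at this
  omega

/-- `c` has `s` as a last letter. -/
def D (c : M m) (s : X × Bool) : Prop := ∃ a, c = a * g m s

/-- `c` has a last letter with generator `x`. -/
def DN (c : M m) (x : X) : Prop := ∃ s, s.1 = x ∧ D c s

end ThreeFree

namespace ThreeFree

open Dihedral

variable {X : Type*} {m : X → X → ℕ∞}

/-- Every letter of `c` has generator `x` or `y`. -/
def Ov (x y : X) (c : M m) : Prop := supp c ⊆ {x, y}

/-- `c` is a power of `x`, up to cancellation. -/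
def Pw (x : X) (c : M m) : Prop := supp c ⊆ {x}

/-- The state of an element of the monoid supported on `{x, y}`. -/
noncomputable def st (k : ℕ) (x : X) (c : M m) : State := val k x (cl_surj c).choose

theorem D.mul_left {c : M m} {s : X × Bool} (h : D c s) (a : M m) : D (a * c) s := by
  obtain ⟨b, rfl⟩ := h
  exact ⟨a * b, (mul_assoc _ _ _).symm⟩

theorem DN.mul_left {c : M m} {x : X} (h : DN c x) (a : M m) : DN (a * c) x := by
  obtain ⟨s, hs, h⟩ := h
  exact ⟨s, hs, h.mul_left a⟩

theorem d_mul_g (a : M m) (s : X × Bool) : D (a * g m s) s := ⟨a, rfl⟩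

variable [ThreeFree m]

@[simp] theorem ov_mul {x y : X} {a b : M m} : Ov x y (a * b) ↔ Ov x y a ∧ Ov x y b := by
  simp [Ov]

@[simp] theorem ov_g {x y : X} {s : X × Bool} : Ov x y (g m s) ↔ s.1 = x ∨ s.1 = y := by
  simp [Ov]

@[simp] theorem ov_one {x y : X} : Ov x y (1 : M m) := by simp [Ov]

@[simp] theorem pw_mul {x : X} {a b : M m} : Pw x (a * b) ↔ Pw x a ∧ Pw x b := by
  simp only [Pw, supp_mul, Set.union_subset_iff]

@[simp] theorem pw_g {x : X} {s : X × Bool} : Pw x (g m s) ↔ s.1 = x := by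
  simp [Pw]

@[simp] theorem pw_one {x : X} : Pw x (1 : M m) := by simp [Pw]

omit [ThreeFree m] in
theorem Ov.symm {x y : X} {a : M m} (h : Ov x y a) : Ov y x a := by
  rwa [Ov, Set.pair_comm]

omit [ThreeFree m] in
theorem Pw.ov {x : X} {a : M m} (h : Pw x a) (y : X) : Ov x y a :=
  h.trans fun _ hz => Or.inl hz

omit [ThreeFree m] in
theorem Pw.ov' {x : X} {a : M m} (h : Pw x a) (y : X) : Ov y x a := (h.ov y).symm

section

variable {x y : X} {k : ℕ} (hl : Lab m x y k)
include hl

theorem st_cl {w : Word X} (hw : Over x y w) : st k x (cl m w) = val k x w :=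
  (run_eq_of_cl_eq hl (cl_surj (cl m w)).choose_spec.symm hw
    (ξ := State.base 0) trivial).symm

omit hl in
theorem exists_word {c : M m} (hc : Ov x y c) : ∃ w, cl m w = c ∧ Over x y w := by
  obtain ⟨w, rfl⟩ := cl_surj c
  exact ⟨w, rfl, over_iff.2 (by simpa [Ov] using hc)⟩

theorem st_one : st k x (1 : M m) = State.base 0 :=
  st_cl hl (w := []) (by simp [Over])

theorem wf_st (c : M m) : WF k (st k x c) := wf_val hl.two_le _ _

theorem st_mul_g {a : M m} (ha : Ov x y a) {s : X × Bool} (hs : s.1 = x ∨ s.1 = y) :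
    st k x (a * g m s) = act k (toDi x s) (st k x a) := by
  obtain ⟨w, rfl, hw⟩ := exists_word ha
  rw [g, ← cl_append, st_cl hl, st_cl hl hw, val_snoc]
  intro p hp
  rw [List.mem_append, List.mem_singleton] at hp
  rcases hp with hp | rfl
  exacts [hw p hp, hs]

theorem len_st_le {c : M m} (hc : Ov x y c) : len k (st k x c) ≤ ln c := by
  obtain ⟨w, rfl, hw⟩ := exists_word hc
  rw [st_cl hl hw, ln_cl]
  exact len_val_le hl.two_le _ _

theorem geo_left {a b : M m} (h : Ov x y (a * b)) (hg : len k (st k x (a * b)) = ln (a * b)) :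
    len k (st k x a) = ln a := by
  rw [ov_mul] at h
  obtain ⟨u, rfl, hu⟩ := exists_word h.1
  obtain ⟨w, rfl, hw⟩ := exists_word h.2
  rw [← cl_append, st_cl hl, ln_cl] at hg
  · rw [st_cl hl hu, ln_cl]
    exact Geo.of_append hl.two_le hg
  · intro p hp
    rcases List.mem_append.1 hp with hp | hp
    exacts [hu p hp, hw p hp]

theorem desc_of_geo {a : M m} {s : X × Bool} (h : Ov x y (a * g m s))
    (hg : len k (st k x (a * g m s)) = ln (a * g m s)) :
    Desc k (st k x (a * g m s)) (toDi x s) := by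
  rw [ov_mul, ov_g] at h
  rw [Desc, hg, st_mul_g hl h.1 h.2, act_inv_act hl.two_le _ (wf_st hl a)]
  have := len_st_le hl h.1
  simp only [ln_mul, ln_g]
  omega

theorem eq_of_st_eq {a b : M m} (ha : Ov x y a) (hb : Ov x y b)
    (hga : len k (st k x a) = ln a) (hgb : len k (st k x b) = ln b)
    (h : st k x a = st k x b) : a = b := by
  induction hn : ln a generalizing a b with
  | zero =>
    obtain rfl := eq_one_of_ln hn
    rw [eq_one_of_ln (c := b)]
    rw [← h, hga, ln_one] at hgb
    exact_mod_cast hgb.symm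
  | succ n ih =>
    have hln : ln a = ln b := by
      rw [← h, hga] at hgb
      exact_mod_cast hgb
    rcases eq_one_or a with rfl | ⟨a', s, rfl⟩
    · simp at hn
    rcases eq_one_or b with rfl | ⟨b', t, rfl⟩
    · simp at hln
    have ha' := ha
    have hb' := hb
    rw [ov_mul, ov_g] at ha' hb'
    have hs := desc_of_geo hl ha hga
    have ht := desc_of_geo hl hb hgb
    by_cases hst : s.1 = t.1
    · rcases eq_or_eq_inv hst with rfl | rfl
      · rw [ih ha'.1 hb'.1 (geo_left hl ha hga) (geo_left hl hb hgb) _ (by simpa using hn)]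
        rw [st_mul_g hl ha'.1 ha'.2, st_mul_g hl hb'.1 hb'.2] at h
        rw [← act_inv_act hl.two_le (toDi x s) (wf_st hl a'), h,
          act_inv_act hl.two_le _ (wf_st hl b')]
      · rw [h, toDi_inv] at hs
        exact (not_desc_desc_inv hl.two_le (wf_st hl _) ht hs).elim
    · obtain ⟨u, rfl, hu⟩ := exists_word ha'.1
      obtain ⟨w, rfl, hw⟩ := exists_word hb'.1
      have hu' : Over x y (u ++ [s]) := by
        intro p hp
        rw [List.mem_append, List.mem_singleton] at hp
        rcases hp with hp | rfl
        exacts [hu p hp, ha'.2]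
      have hw' : Over x y (w ++ [t]) := by
        intro p hp
        rw [List.mem_append, List.mem_singleton] at hp
        rcases hp with hp | rfl
        exacts [hw p hp, hb'.2]
      refine cl_eq_of_rel ⟨x, y, k, u, s, w, t, hl, rfl, rfl, hst, hu', hw', ?_, ?_, ?_⟩
      · rw [g, ← cl_append, st_cl hl hu', ln_cl] at hga
        exact hga
      · rw [g, ← cl_append, st_cl hl hw', ln_cl] at hgb
        exact hgb
      · rw [g, g, ← cl_append, ← cl_append, st_cl hl hu', st_cl hl hw'] at h
        exact h

theorem exists_st_eq {ξ : State} (h : WF k ξ) :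
    ∃ c : M m, Ov x y c ∧ st k x c = ξ ∧ len k (st k x c) = ln c := by
  obtain ⟨n, hn⟩ : ∃ n : ℕ, len k ξ = n := ⟨_, (Int.toNat_of_nonneg (len_nonneg k ξ)).symm⟩
  induction n using Nat.strong_induction_on generalizing ξ with
  | _ n ih =>
    by_cases h0 : ξ = State.base 0
    · subst h0
      exact ⟨1, ov_one, st_one hl, by rw [st_one hl, len_base_zero, ln_one]; rfl⟩
    obtain ⟨p, hp⟩ := exists_desc hl.two_le h h0
    obtain ⟨s, hs, rfl⟩ := exists_toDi hl.1 p
    have h1 := len_act_cases hl.two_le (inv (toDi x s)) h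
    rw [inv_inv] at h1
    have h2 : len k (act k (inv (toDi x s)) ξ) = len k ξ - 1 := by tauto
    have h3 := len_nonneg k (act k (inv (toDi x s)) ξ)
    obtain ⟨c, hc, hc1, hc2⟩ := ih (n - 1) (by omega)
      (wf_act hl.two_le (inv (toDi x s)) h) (by omega)
    have h4 : st k x (c * g m s) = ξ := by
      rw [st_mul_g hl hc hs, hc1, act_act_inv hl.two_le _ h]
    refine ⟨c * g m s, ov_mul.2 ⟨hc, ov_g.2 hs⟩, h4, ?_⟩
    rw [h4, ln_mul, ln_g]
    rw [hc1] at hc2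
    push_cast
    omega

theorem d_of_desc {c : M m} (hc : Ov x y c) (hg : len k (st k x c) = ln c) {s : X × Bool}
    (hs : s.1 = x ∨ s.1 = y) (hd : Desc k (st k x c) (toDi x s)) :
    ∃ a, Ov x y a ∧ c = a * g m s := by
  obtain ⟨a, ha, ha1, ha2⟩ := exists_st_eq hl (wf_act hl.two_le (inv (toDi x s)) (wf_st hl c))
  have h1 := len_act_cases hl.two_le (inv (toDi x s)) (wf_st hl c)
  rw [inv_inv] at h1
  have h2 : len k (act k (inv (toDi x s)) (st k x c)) = len k (st k x c) - 1 := by tauto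
  have h4 : st k x (a * g m s) = st k x c := by
    rw [st_mul_g hl ha hs, ha1, act_act_inv hl.two_le _ (wf_st hl c)]
  refine ⟨a, ha, eq_of_st_eq hl hc (ov_mul.2 ⟨ha, ov_g.2 hs⟩) hg ?_ h4.symm⟩
  rw [h4, ln_mul, ln_g]
  rw [ha1] at ha2
  push_cast
  omega

theorem red_iff {c : M m} (hc : Ov x y c) : Red c ↔ len k (st k x c) = ln c := by
  constructor
  · induction c using M_induction with
    | one => intro _; rw [st_one hl, len_base_zero, ln_one]; rfl
    | mul a s ih =>
      intro hr
      rw [ov_mul, ov_g] at hc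
      have h1 := ih hc.1 hr.left
      rw [st_mul_g hl hc.1 hc.2, ln_mul, ln_g]
      rcases len_act_cases hl.two_le (toDi x s) (wf_st hl a) with ⟨hd, _⟩ | ⟨_, h2⟩
      · rw [← toDi_inv] at hd
        obtain ⟨b, -, rfl⟩ := d_of_desc hl hc.1 h1 (s := inv s) hc.2 hd
        refine absurd (hr b (inv s) 1) ?_
        simp
      · rw [h2, h1]; push_cast; rfl
  · intro h
    rintro a s b rfl
    have h1 := geo_left hl hc h
    rw [ov_mul, ov_mul, ov_mul, ov_g, ov_g] at hc
    rw [st_mul_g hl (ov_mul.2 ⟨hc.1.1.1, ov_g.2 hc.1.1.2⟩) hc.1.2, st_mul_g hl hc.1.1.1 hc.1.1.2,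
      toDi_inv, act_inv_act hl.two_le _ (wf_st hl a)] at h1
    have := len_st_le hl hc.1.1.1
    simp at h1
    omega

end

end ThreeFree

namespace ThreeFree

open Dihedral

variable {X : Type*} {m : X → X → ℕ∞} [ThreeFree m]

/-- `ξ` is an element over `x, y` having last letters with both generators. -/
def Full (x y : X) (ξ : M m) : Prop := Ov x y ξ ∧ DN ξ x ∧ DN ξ y

theorem Lab.four_le {x y : X} {k : ℕ} (hl : Lab m x y k) (h : m x y ≠ 2) : 4 ≤ k := by
  have h1 := hl.two_le
  have h2 := ThreeFree.ne_three (m := m) x y hl.1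
  rw [hl.2] at h h2
  have h3 : k ≠ 2 := by rintro rfl; exact h rfl
  have h4 : k ≠ 3 := by rintro rfl; exact h2 rfl
  omega

omit [ThreeFree m] in
omit [ThreeFree m] in
theorem lab_two {x y : X} (hxy : x ≠ y) (h : m x y = 2) : Lab m x y 2 := ⟨hxy, h⟩

section

variable {x y : X} {k : ℕ} (hl : Lab m x y k)
include hl

theorem desc_of_d {a : M m} {s : X × Bool} (ho : Ov x y (a * g m s)) (hr : Red (a * g m s)) :
    Desc k (st k x (a * g m s)) (toDi x s) :=
  desc_of_geo hl ho ((red_iff hl ho).1 hr)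

theorem red_mul_g {ξ : M m} (ho : Ov x y ξ) (hr : Red ξ) {s : X × Bool} (hs : s.1 = x ∨ s.1 = y)
    (hd : ¬ D ξ (inv s)) : Red (ξ * g m s) := by
  have hg := (red_iff hl ho).1 hr
  rw [red_iff hl (ov_mul.2 ⟨ho, ov_g.2 hs⟩), st_mul_g hl ho hs, ln_mul, ln_g]
  rcases len_act_cases hl.two_le (toDi x s) (wf_st hl ξ) with ⟨h1, -⟩ | ⟨-, h1⟩
  · obtain ⟨a, -, ha⟩ := d_of_desc hl ho hg (s := inv s) hs h1
    exact absurd ⟨a, ha⟩ hd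
  · rw [h1, hg]
    push_cast
    rfl

theorem cancel {η θ : M m} {s : X × Bool} (ho : Ov x y (η * g m s)) (ho' : Ov x y (θ * g m s))
    (hr : Red (η * g m s)) (h : η * g m s = θ * g m s) : η = θ := by
  have h1 := (red_iff hl (ov_mul.1 ho).1).1 hr.left
  have h2 := (red_iff hl (ov_mul.1 ho').1).1 (h ▸ hr).left
  refine eq_of_st_eq hl (ov_mul.1 ho).1 (ov_mul.1 ho').1 h1 h2 ?_
  have h3 := congrArg (st k x) h
  rw [ov_mul, ov_g] at ho ho'
  rw [st_mul_g hl ho.1 ho.2, st_mul_g hl ho'.1 ho.2] at h3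
  rw [← act_inv_act hl.two_le (toDi x s) (wf_st hl η), h3, act_inv_act hl.two_le _ (wf_st hl θ)]

theorem not_d_inv {η θ : M m} {s : X × Bool} (ho : Ov x y (η * g m s)) (hr : Red (η * g m s))
    (h : η * g m s = θ * g m (inv s)) : False := by
  have h1 := desc_of_d hl ho hr
  have h2 := desc_of_d hl (h ▸ ho) (h ▸ hr)
  rw [← h] at h2
  exact not_desc_desc_inv hl.two_le (wf_st hl _) h1 h2

theorem exists_d_of_full {η θ : M m} {s t : X × Bool} (ho : Ov x y (η * g m s))
    (hr : Red (η * g m s)) (h : η * g m s = θ * g m t) (hst : s.1 ≠ t.1) :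
    ∃ r κ, r.1 = t.1 ∧ Ov x y κ ∧ η = κ * g m r := by
  have h1 := desc_of_d hl ho hr
  have h2 := desc_of_d hl (h ▸ ho) (h ▸ hr)
  rw [← h] at h2
  have ht : t.1 = x ∨ t.1 = y := (ov_g.1 (ov_mul.1 (h ▸ ho)).2)
  have ho1 := ho
  rw [ov_mul, ov_g] at ho
  have hg := (red_iff hl ho.1).1 hr.left
  obtain ⟨r', hr1, hr2⟩ := exists_desc_of_desc hl.two_le (wf_st hl _) h1 h2
    (toDi_fst_ne ho.2 ht hst)
  rw [st_mul_g hl ho.1 ho.2, act_inv_act hl.two_le _ (wf_st hl η)] at hr2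
  obtain ⟨r, hr, rfl⟩ := exists_toDi hl.1 r'
  obtain ⟨κ, hκ, hκ'⟩ := d_of_desc hl ho.1 hg hr hr2
  refine ⟨r, κ, ?_, hκ, hκ'⟩
  by_contra hne
  exact toDi_fst_ne hr ht hne hr1

theorem full_levels {ξ : M m} (hr : Red ξ) (hf : Full x y ξ) : levels k (st k x ξ) = k := by
  obtain ⟨ho, ⟨s, hs, η, h1⟩, ⟨t, ht, θ, h2⟩⟩ := hf
  refine levels_eq_of_desc hl.two_le (wf_st hl ξ) (s := toDi x s) (t := toDi x t) ?_ ?_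
    (toDi_fst_ne (Or.inl hs) (Or.inr ht) (by rw [hs, ht]; exact hl.1))
  · rw [h1] at hr ho ⊢
    exact desc_of_d hl ho hr
  · rw [h2] at hr ho ⊢
    exact desc_of_d hl ho hr

theorem levels_mul_le {ξ p : M m} {z : X} (ho : Ov x y (ξ * p)) (hr : Red (ξ * p)) (hp : Pw z p) :
    levels k (st k x (ξ * p)) ≤ levels k (st k x ξ) + 1 := by
  rw [red_iff hl ho] at hr
  rw [ov_mul] at ho
  obtain ⟨u, rfl, hu⟩ := exists_word ho.1
  obtain ⟨w, rfl, hw⟩ := exists_word ho.2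
  have huw : Over x y (u ++ w) := by
    intro p hp
    rcases List.mem_append.1 hp with hp | hp
    exacts [hu p hp, hw p hp]
  rw [← cl_append, st_cl hl huw, ln_cl] at hr
  rw [← cl_append, st_cl hl huw, st_cl hl hu]
  exact levels_le_of_single hl.two_le (by simpa [Pw] using hp) hr

theorem not_full_of_three {p₁ p₂ p₃ : M m} {z₁ z₂ z₃ : X} (hp₁ : Pw z₁ p₁) (hp₂ : Pw z₂ p₂)
    (hp₃ : Pw z₃ p₃) (hk : m x y ≠ 2) (hr : Red (p₁ * p₂ * p₃))
    (hf : Full x y (p₁ * p₂ * p₃)) : False := by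
  have h0 := full_levels hl hr hf
  have ho := hf.1
  have h3 := levels_mul_le hl ho hr hp₃
  rw [ov_mul] at ho
  have h2 := levels_mul_le hl ho.1 hr.left hp₂
  rw [ov_mul] at ho
  have h1 := levels_mul_le (ξ := 1) hl (by simpa using ho.1.1) (by simpa using hr.left.left) hp₁
  rw [st_one hl, one_mul] at h1
  have h4 : levels k (State.base 0) = 0 := by simp [levels, expo]
  have := hl.four_le hk
  omega

end

theorem comm {s t : X × Bool} (hst : s.1 ≠ t.1) (h : m s.1 t.1 = 2) :
    g m s * g m t = g m t * g m s := by
  have hl := lab_two hst h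
  have ho : Over s.1 t.1 [s, t] := by simp [Over]
  have ho' : Over s.1 t.1 [t, s] := by simp [Over]
  have h1 : g m s * g m t = cl m [s, t] := rfl
  have h2 : g m t * g m s = cl m [t, s] := rfl
  have hov : ∀ w, Over s.1 t.1 w → Ov s.1 t.1 (cl m w) := fun w hw => by
    rw [Ov, supp_cl]; exact over_iff.1 hw
  rw [h1, h2]
  obtain ⟨x, δ⟩ := s
  obtain ⟨y, ε⟩ := t
  refine eq_of_st_eq hl (hov _ ho) (hov _ ho') ?_ ?_ ?_ <;>
    simp only [st_cl hl ho, st_cl hl ho', ln_cl] <;> cases δ <;> cases ε <;>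
    simp [val, toDi, act, Ne.symm hst, ofList, len, expo, Finset.sum_range_succ]

/-- In the commuting case, two different last letters can be removed together. -/
theorem exists_common {x y : X} (hl : Lab m x y 2) {η θ : M m} {s t : X × Bool}
    (ho : Ov x y (η * g m s)) (hr : Red (η * g m s)) (h : η * g m s = θ * g m t)
    (hst : s.1 ≠ t.1) : ∃ κ, Ov x y κ ∧ η = κ * g m t ∧ θ = κ * g m s := by
  obtain ⟨r, κ, hrt, hκ, rfl⟩ := exists_d_of_full hl ho hr h hst
  have hs := ov_g.1 (ov_mul.1 ho).2
  have ho' : Ov x y (θ * g m t) := h ▸ ho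
  have ht := ov_g.1 (ov_mul.1 ho').2
  have hm2 : m s.1 r.1 = 2 := by
    have h2 : m x y = 2 := hl.2
    have h2' := hl.symm.2
    rw [hrt]
    rcases hs with hs | hs <;> rcases ht with ht | ht <;>
      first
      | exact absurd (hs.trans ht.symm) hst
      | (rw [hs, ht]; first | exact h2 | exact h2')
  have hc := comm (m := m) (s := s) (t := r) (by rwa [hrt]) hm2
  have h1 : κ * g m r * g m s = κ * g m s * g m r := by rw [mul_assoc, ← hc, mul_assoc]
  rcases eq_or_eq_inv hrt with rfl | rfl
  · refine ⟨κ, hκ, rfl, ?_⟩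
    have hcs : Ov x y (κ * g m s * g m r) := h1 ▸ ho
    exact cancel hl ho' hcs (h ▸ hr) (h.symm.trans h1)
  · rw [h1] at h
    rw [h] at h1
    exact (not_d_inv hl ho' (h1 ▸ hr) h.symm).elim

end ThreeFree

namespace ThreeFree

open Dihedral

variable {X : Type*} {m : X → X → ℕ∞}

/-- `c` has no last letter with generator `x` or `y`. -/
def Free (x y : X) (c : M m) : Prop := ¬ DN c x ∧ ¬ DN c y

theorem Free.symm {x y : X} {c : M m} (h : Free x y c) : Free y x c := ⟨h.2, h.1⟩

theorem Free.not_eq {x y : X} {c : M m} (h : Free x y c) {a : M m} {s : X × Bool}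
    (hs : s.1 = x ∨ s.1 = y) (hc : c = a * g m s) : False := by
  rcases hs with hs | hs
  · exact h.1 ⟨s, hs, a, hc⟩
  · exact h.2 ⟨s, hs, a, hc⟩

/-- The elements `a * s` and `b * t` are equal by a single dihedral relation. -/
def Lk (p q : M m × (X × Bool)) : Prop :=
  p.2.1 ≠ q.2.1 ∧ (∃ k, Lab m p.2.1 q.2.1 k) ∧ ∃ c η θ, Ov p.2.1 q.2.1 η ∧ Ov p.2.1 q.2.1 θ ∧
    η * g m p.2 = θ * g m q.2 ∧ p.1 = c * η ∧ q.1 = c * θ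

/-- The strong form of a link: the common left factor is as short as possible. -/
def SL (a : M m) (s : X × Bool) (b : M m) (t : X × Bool) : Prop :=
  (a = b ∧ s = t) ∨ (s.1 ≠ t.1 ∧ (∃ k, Lab m s.1 t.1 k) ∧ ∃ c η θ, Free s.1 t.1 c ∧
    Ov s.1 t.1 η ∧ Ov s.1 t.1 θ ∧ η * g m s = θ * g m t ∧ a = c * η ∧ b = c * θ)

variable (m) in
/-- Any two last letters of a reduced element of length at most `n` are strongly linked. -/
def Good (n : ℕ) : Prop := ∀ (a : M m) s b t, Red (a * g m s) → ln (a * g m s) ≤ n →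
  a * g m s = b * g m t → SL a s b t

theorem pair_cases {x y u v : X} (hu : u = x ∨ u = y) (hv : v = x ∨ v = y) (h : u ≠ v) :
    (u = x ∧ v = y) ∨ (u = y ∧ v = x) := by
  grind

variable [ThreeFree m]

theorem Lk.symm {p q : M m × (X × Bool)} (h : Lk p q) : Lk q p := by
  obtain ⟨h1, ⟨k, h2⟩, c, η, θ, h3, h4, h5, h6, h7⟩ := h
  exact ⟨h1.symm, ⟨k, h2.symm⟩, c, θ, η, h4.symm, h3.symm, h5.symm, h7, h6⟩

theorem SL.symm {a b : M m} {s t : X × Bool} (h : SL a s b t) : SL b t a s := by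
  rcases h with ⟨rfl, rfl⟩ | ⟨h1, ⟨k, h2⟩, c, η, θ, h0, h3, h4, h5, h6, h7⟩
  · exact Or.inl ⟨rfl, rfl⟩
  · exact Or.inr ⟨h1.symm, ⟨k, h2.symm⟩, c, θ, η, h0.symm, h4.symm, h3.symm, h5.symm, h7, h6⟩

omit [ThreeFree m] in
theorem SL.over {a b : M m} {s t : X × Bool} (h : SL a s b t) {x y : X} (hst : s.1 ≠ t.1)
    (hs : s.1 = x ∨ s.1 = y) (ht : t.1 = x ∨ t.1 = y) :
    ∃ c η θ, Free x y c ∧ Ov x y η ∧ Ov x y θ ∧ η * g m s = θ * g m t ∧ a = c * η ∧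
      b = c * θ := by
  rcases h with ⟨-, rfl⟩ | ⟨-, -, c, η, θ, h0, h3, h4, h5, h6, h7⟩
  · exact absurd rfl hst
  · rcases pair_cases hs ht hst with ⟨rfl, rfl⟩ | ⟨rfl, rfl⟩
    · exact ⟨c, η, θ, h0, h3, h4, h5, h6, h7⟩
    · exact ⟨c, η, θ, h0.symm, h3.symm, h4.symm, h5, h6, h7⟩

omit [ThreeFree m] in
theorem eqvGen_lk_mul_left (u : M m) {p q : M m × (X × Bool)} (h : Relation.EqvGen Lk p q) :
    Relation.EqvGen Lk (u * p.1, p.2) (u * q.1, q.2) := by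
  induction h with
  | rel p q h =>
    obtain ⟨h1, h2, c, η, θ, h3, h4, h5, h6, h7⟩ := h
    exact .rel _ _ ⟨h1, h2, u * c, η, θ, h3, h4, h5, by rw [h6, mul_assoc], by rw [h7, mul_assoc]⟩
  | refl p => exact .refl _
  | symm p q _ ih => exact .symm _ _ ih
  | trans p q r _ _ ih1 ih2 => exact .trans _ _ _ ih1 ih2

theorem eqvGen_lk {a b : M m} {s t : X × Bool} (h : a * g m s = b * g m t) :
    Relation.EqvGen Lk (a, s) (b, t) := by
  obtain ⟨u, rfl⟩ := cl_surj a
  obtain ⟨w, rfl⟩ := cl_surj b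
  rw [g, g, ← cl_append, ← cl_append] at h
  suffices H : cl m (u ++ [s]) = cl m (w ++ [t]) ∧ ∀ a p b q, u ++ [s] = a ++ [p] →
      w ++ [t] = b ++ [q] → Relation.EqvGen Lk (cl m a, p) (cl m b, q) from H.2 _ _ _ _ rfl rfl
  refine cl_induction (P := fun w w' => cl m w = cl m w' ∧ ∀ a p b q, w = a ++ [p] →
      w' = b ++ [q] → Relation.EqvGen Lk (cl m a, p) (cl m b, q)) ?_ ?_ ?_ ?_ ?_ h
  · rintro w w' hrel
    refine ⟨cl_eq_of_rel hrel, ?_⟩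
    have h0 := cl_eq_of_rel hrel
    obtain ⟨x, y, k, u, s, u', t, hl, rfl, rfl, hst, ho, ho', hg, hg', hv⟩ := hrel
    rintro a p b q h1 h2
    obtain ⟨rfl, h1⟩ := List.append_inj' h1 rfl
    obtain ⟨rfl, h2⟩ := List.append_inj' h2 rfl
    obtain rfl : s = p := by simpa using h1
    obtain rfl : t = q := by simpa using h2
    rw [cl_append, cl_append] at h0
    have ho1 : Ov x y (cl m u) := by
      rw [Ov, supp_cl, ← over_iff]
      exact fun p hp => ho p (List.mem_append_left _ hp)
    have ho2 : Ov x y (cl m u') := by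
      rw [Ov, supp_cl, ← over_iff]
      exact fun p hp => ho' p (List.mem_append_left _ hp)
    rcases pair_cases (ho s (by simp)) (ho' t (by simp)) hst with ⟨rfl, rfl⟩ | ⟨rfl, rfl⟩
    · exact .rel _ _ ⟨hst, ⟨k, hl⟩, 1, cl m u, cl m u', ho1, ho2, h0, (one_mul _).symm,
        (one_mul _).symm⟩
    · exact .rel _ _ ⟨hst, ⟨k, hl.symm⟩, 1, cl m u, cl m u', ho1.symm, ho2.symm, h0,
        (one_mul _).symm, (one_mul _).symm⟩
  · rintro w
    refine ⟨rfl, ?_⟩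
    rintro a p b q rfl h2
    obtain ⟨rfl, h2⟩ := List.append_inj' h2 rfl
    obtain rfl : p = q := by simpa using h2
    exact .refl _
  · rintro w w' ⟨h1, h2⟩
    exact ⟨h1.symm, fun a p b q ha hb => .symm _ _ (h2 b q a p hb ha)⟩
  · rintro w w' w'' ⟨h1, h2⟩ ⟨h3, h4⟩
    refine ⟨h1.trans h3, fun a p b q ha hb => ?_⟩
    rcases List.eq_nil_or_concat w' with rfl | ⟨c, r, rfl⟩
    · have := length_eq_of_cl_eq h1
      simp [ha] at this
    · rw [List.concat_eq_append] at h2 h4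
      exact .trans _ _ _ (h2 a p c r ha rfl) (h4 c r b q rfl hb)
  · rintro u u' v v' ⟨h1, h2⟩ ⟨h3, h4⟩
    refine ⟨by rw [cl_append, cl_append, h1, h3], fun a p b q ha hb => ?_⟩
    have hlen := length_eq_of_cl_eq h3
    rcases List.eq_nil_or_concat v with rfl | ⟨c, r, rfl⟩
    · obtain rfl : v' = [] := List.eq_nil_of_length_eq_zero hlen.symm
      exact h2 a p b q (by simpa using ha) (by simpa using hb)
    rcases List.eq_nil_or_concat v' with rfl | ⟨c', r', rfl⟩
    · simp at hlen
    rw [List.concat_eq_append, ← List.append_assoc] at ha hb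
    obtain ⟨rfl, ha⟩ := List.append_inj' ha rfl
    obtain ⟨rfl, hb⟩ := List.append_inj' hb rfl
    obtain rfl : r = p := by simpa using ha
    obtain rfl : r' = q := by simpa using hb
    rw [List.concat_eq_append, List.concat_eq_append] at h4
    rw [cl_append, cl_append, h1]
    exact eqvGen_lk_mul_left (cl m u') (h4 c r c' r' rfl rfl)

theorem exists_decomp (x y : X) (c : M m) :
    ∃ c₀ ξ, c = c₀ * ξ ∧ Free x y c₀ ∧ Ov x y ξ := by
  induction hn : ln c generalizing c with
  | zero =>
    obtain rfl := eq_one_of_ln hn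
    refine ⟨1, 1, (one_mul _).symm, ?_, ov_one⟩
    constructor <;> rintro ⟨s, -, a, h⟩ <;> simpa using congrArg ln h
  | succ n ih =>
    by_cases hf : Free x y c
    · exact ⟨c, 1, (mul_one _).symm, hf, ov_one⟩
    · obtain ⟨s, hs, a, rfl⟩ : ∃ s : X × Bool, (s.1 = x ∨ s.1 = y) ∧ D c s := by
        rw [Free] at hf
        by_cases h : DN c x
        · obtain ⟨s, hs, h⟩ := h
          exact ⟨s, Or.inl hs, h⟩
        · have : DN c y := by tauto
          obtain ⟨s, hs, h⟩ := this
          exact ⟨s, Or.inr hs, h⟩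
      obtain ⟨c₀, ξ, rfl, h1, h2⟩ := ih a (by simpa using hn)
      exact ⟨c₀, ξ * g m s, mul_assoc _ _ _, h1, ov_mul.2 ⟨h2, ov_g.2 hs⟩⟩

section

variable {n : ℕ} (hG : Good m n)
include hG

theorem decomp_aux {x y : X} {c₀ ξ : M m} (hf : Free x y c₀) (ho : Ov x y ξ) (hr : Red (c₀ * ξ))
    (hn : ln (c₀ * ξ) ≤ n) :
    (∀ a s, (s.1 = x ∨ s.1 = y) → c₀ * ξ = a * g m s → ∃ η, Ov x y η ∧ ξ = η * g m s ∧
      a = c₀ * η) ∧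
    (∀ c₁ ζ, Free x y c₁ → Ov x y ζ → c₀ * ξ = c₁ * ζ → c₀ = c₁ ∧ ξ = ζ) := by
  induction hN : ln (c₀ * ξ) generalizing c₀ ξ with
  | zero =>
    have h1 := eq_one_of_ln hN
    have h2 : ∀ c d : M m, 1 = c * d → c = 1 ∧ d = 1 := fun c d h => by
      have := congrArg ln h
      rw [ln_one, ln_mul] at this
      exact ⟨eq_one_of_ln (by omega), eq_one_of_ln (by omega)⟩
    rw [h1]
    refine ⟨fun a s _ h => ?_, fun c₁ ζ _ _ h => ?_⟩
    · simpa using congrArg ln h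
    · obtain ⟨rfl, rfl⟩ := h2 _ _ h1.symm
      obtain ⟨rfl, rfl⟩ := h2 _ _ h
      exact ⟨rfl, rfl⟩
  | succ N ih =>
    have A : ∀ {c₀ ξ : M m}, Free x y c₀ → Ov x y ξ → Red (c₀ * ξ) → ln (c₀ * ξ) = N + 1 →
        ∀ a s, (s.1 = x ∨ s.1 = y) → c₀ * ξ = a * g m s → ∃ η, Ov x y η ∧ ξ = η * g m s ∧
        a = c₀ * η := by
      intro c₀ ξ hf ho hr hN' a s hs h
      rcases eq_one_or ξ with rfl | ⟨ξ', t, rfl⟩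
      · rw [mul_one] at h
        exact (hf.not_eq hs h).elim
      rw [ov_mul, ov_g] at ho
      rw [← mul_assoc] at h hr hN'
      rcases Classical.em (t.1 = s.1) with hts | hts
      · have := hG _ _ _ _ hr (by omega) h
        rcases this with ⟨rfl, rfl⟩ | ⟨h1, -⟩
        · exact ⟨ξ', ho.1, rfl, rfl⟩
        · exact absurd hts h1
      · obtain ⟨e, η, θ, he, hη, hθ, hηθ, h1, rfl⟩ :=
          (hG _ _ _ _ hr (by omega) h).over hts ho.2 hs
        simp only [ln_mul, ln_g] at hN'
        obtain ⟨rfl, rfl⟩ := (ih hf ho.1 hr.left (by rw [ln_mul]; omega)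
          (by rw [ln_mul]; omega)).2 e η he hη h1
        exact ⟨θ, hθ, hηθ, rfl⟩
    refine ⟨A hf ho hr hN, fun c₁ ζ hc₁ hζ h => ?_⟩
    rcases eq_one_or ζ with rfl | ⟨ζ', t, rfl⟩
    · rcases eq_one_or ξ with rfl | ⟨ξ', s, rfl⟩
      · simpa using h
      · rw [mul_one, ← mul_assoc] at h
        rw [ov_mul, ov_g] at ho
        exact (hc₁.not_eq ho.2 h.symm).elim
    · rw [ov_mul, ov_g] at hζ
      rw [← mul_assoc] at h
      obtain ⟨η, hη, rfl, h1⟩ := A hf ho hr hN _ t hζ.2 h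
      rw [← mul_assoc] at hr
      simp only [ln_mul, ln_g] at hN hn
      obtain ⟨rfl, rfl⟩ := (ih hf hη hr.left (by rw [ln_mul]; omega)
        (by rw [ln_mul]; omega)).2 c₁ ζ' hc₁ hζ.1 h1.symm
      exact ⟨rfl, rfl⟩

theorem decomp_d {x y : X} {c₀ ξ a : M m} {s : X × Bool} (hf : Free x y c₀) (ho : Ov x y ξ)
    (hr : Red (c₀ * ξ)) (hn : ln (c₀ * ξ) ≤ n) (hs : s.1 = x ∨ s.1 = y)
    (h : c₀ * ξ = a * g m s) : ∃ η, Ov x y η ∧ ξ = η * g m s ∧ a = c₀ * η :=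
  (decomp_aux hG hf ho hr hn).1 a s hs h

theorem decomp_unique {x y : X} {c₀ ξ c₁ ζ : M m} (hf : Free x y c₀) (ho : Ov x y ξ)
    (hr : Red (c₀ * ξ)) (hn : ln (c₀ * ξ) ≤ n) (hf' : Free x y c₁) (ho' : Ov x y ζ)
    (h : c₀ * ξ = c₁ * ζ) : c₀ = c₁ ∧ ξ = ζ :=
  (decomp_aux hG hf ho hr hn).2 c₁ ζ hf' ho' h

theorem red_append_aux (N : ℕ) (hN : N ≤ n) :
    (∀ (c : M m) s, ln c = N → Red c → ¬ D c (inv s) → Red (c * g m s)) ∧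
    (∀ {x y k} {c₀ ξ : M m}, Lab m x y k → ln (c₀ * ξ) = N → Red c₀ → Free x y c₀ → Ov x y ξ →
      Red ξ → Red (c₀ * ξ)) := by
  induction N using Nat.strong_induction_on with
  | _ N ih =>
    have PR : ∀ {x y k} {c₀ ξ : M m}, Lab m x y k → ln (c₀ * ξ) = N → Red c₀ → Free x y c₀ →
        Ov x y ξ → Red ξ → Red (c₀ * ξ) := by
      intro x y k c₀ ξ hl hln hc₀ hf ho hr
      rcases eq_one_or ξ with rfl | ⟨ξ', t, rfl⟩
      · rwa [mul_one]
      rw [ov_mul, ov_g] at ho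
      simp only [ln_mul, ln_g] at hln
      obtain ⟨ih1, ih2⟩ := ih (N - 1) (by omega) (by omega)
      have h1 := ih2 hl (by rw [ln_mul]; omega) hc₀ hf ho.1 hr.left
      rw [← mul_assoc]
      refine ih1 _ _ (by rw [ln_mul]; omega) h1 ?_
      rintro ⟨a, ha⟩
      obtain ⟨η, -, rfl, -⟩ := decomp_d hG hf ho.1 h1 (by rw [ln_mul]; omega) (s := inv t) ho.2 ha
      refine hr η (inv t) 1 ?_
      rw [inv_inv, mul_one]
    refine ⟨fun c s hc hr hd => ?_, PR⟩
    have step : ∀ p q : M m × (X × Bool), Lk p q → ln p.1 = N → Red p.1 → ¬ D p.1 (inv p.2) →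
        ln q.1 = N ∧ Red q.1 ∧ ¬ D q.1 (inv q.2) := by
      rintro ⟨a, s⟩ ⟨b, t⟩ ⟨hst, ⟨k, hl⟩, e, η, θ, hη, hθ, hηθ, h1, h2⟩ hln hra hda
      dsimp only at *
      obtain ⟨c₁, κ, rfl, hf, hκ⟩ := exists_decomp s.1 t.1 e
      have hlnθ := congrArg ln hηθ
      rw [mul_assoc] at h1 h2
      subst h1 h2
      have ho1 : Ov s.1 t.1 (κ * η) := ov_mul.2 ⟨hκ, hη⟩
      have ho2 : Ov s.1 t.1 (κ * θ) := ov_mul.2 ⟨hκ, hθ⟩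
      have h3 : Red (κ * η * g m s) := red_mul_g hl ho1 hra.right (Or.inl rfl)
        fun hd => hda (hd.mul_left c₁)
      rw [mul_assoc, hηθ, ← mul_assoc] at h3
      have hlnb : ln (c₁ * (κ * θ)) = N := by
        simp only [ln_mul, ln_g] at hln hlnθ ⊢
        omega
      have h4 := PR hl hlnb hra.left hf ho2 h3.left
      refine ⟨hlnb, h4, ?_⟩
      rintro ⟨d, hd⟩
      obtain ⟨ζ, -, hζ, -⟩ := decomp_d hG hf ho2 h4 (by omega) (s := inv t) (Or.inr rfl) hd
      rw [hζ] at h3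
      refine h3 ζ (inv t) 1 ?_
      rw [inv_inv, mul_one]
    have step' : ∀ p q : M m × (X × Bool), Relation.EqvGen Lk p q →
        ((ln p.1 = N ∧ Red p.1 ∧ ¬ D p.1 (inv p.2)) ↔
          (ln q.1 = N ∧ Red q.1 ∧ ¬ D q.1 (inv q.2))) := by
      intro p q h
      induction h with
      | rel p q h =>
        exact ⟨fun H => step _ _ h H.1 H.2.1 H.2.2, fun H => step _ _ h.symm H.1 H.2.1 H.2.2⟩
      | refl => rfl
      | symm _ _ _ ih => exact ih.symm
      | trans _ _ _ _ _ ih1 ih2 => exact ih1.trans ih2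
    rintro a r b h
    rcases eq_one_or b with rfl | ⟨b, t, rfl⟩
    · rw [mul_one] at h
      refine ((step' _ _ (eqvGen_lk h)).1 ⟨hc, hr, hd⟩).2.2 ⟨a, ?_⟩
      rw [inv_inv]
    · rw [← mul_assoc] at h
      exact ((step' _ _ (eqvGen_lk h)).1 ⟨hc, hr, hd⟩).2.1 a r b rfl

theorem red_append {c : M m} {s : X × Bool} (hn : ln c ≤ n) (hr : Red c) (hd : ¬ D c (inv s)) :
    Red (c * g m s) :=
  (red_append_aux hG _ hn).1 c s rfl hr hd

end

end ThreeFree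

namespace ThreeFree

open Dihedral

variable {X : Type*} {m : X → X → ℕ∞} [ThreeFree m]

theorem Pw.eq_one_or {x : X} {p : M m} (hp : Pw x p) :
    p = 1 ∨ ∃ p' s, p = p' * g m s ∧ s.1 = x ∧ Pw x p' := by
  rcases ThreeFree.eq_one_or p with rfl | ⟨p', s, rfl⟩
  · exact Or.inl rfl
  · rw [pw_mul, pw_g] at hp
    exact Or.inr ⟨p', s, rfl, hp.2, hp.1⟩

theorem Pw.dn {x : X} {p : M m} (hp : Pw x p) (h : p ≠ 1) : DN p x := by
  obtain ⟨p', s, rfl, hs, -⟩ := hp.eq_one_or.resolve_left h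
  exact ⟨s, hs, d_mul_g _ _⟩

theorem Ov.dn_or {x y : X} {ξ : M m} (ho : Ov x y ξ) (h : ξ ≠ 1) : DN ξ x ∨ DN ξ y := by
  obtain ⟨ξ', s, rfl⟩ := (eq_one_or ξ).resolve_left h
  rw [ov_mul, ov_g] at ho
  exact ho.2.imp (fun h => ⟨s, h, d_mul_g _ _⟩) (fun h => ⟨s, h, d_mul_g _ _⟩)

theorem not_dn_of_pw {x y : X} {p : M m} (hxy : x ≠ y) (hp : Pw x p) : ¬ DN p y := by
  rintro ⟨s, rfl, a, rfl⟩
  rw [pw_mul, pw_g] at hp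
  exact hxy hp.2.symm

/-- Every element factors as `η * p` with `p` a power of `x` and `η` not ending in `x`. -/
theorem exists_strip (x : X) (c : M m) : ∃ η p, c = η * p ∧ ¬ DN η x ∧ Pw x p := by
  obtain ⟨η, p, h, hf, ho⟩ := exists_decomp x x c
  exact ⟨η, p, h, hf.1, by simpa [Ov, Pw] using ho⟩

theorem comm_of_supp {p : M m} {t : X × Bool} (h : ∀ u ∈ supp p, u ≠ t.1 ∧ m u t.1 = 2) :
    p * g m t = g m t * p := by
  induction p using M_induction with
  | one => rw [one_mul, mul_one]
  | mul p s ih =>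
    have hs := h s.1 (by simp)
    rw [mul_assoc, comm hs.1 hs.2, ← mul_assoc, ih (fun u hu => h u (by simp [hu])), mul_assoc]

/-- A product of a power of `x` and a power of `y`, in either order. -/
def Syl (x y : X) (ξ : M m) : Prop :=
  ∃ p q, (Pw x p ∧ Pw y q ∨ Pw y p ∧ Pw x q) ∧ ξ = p * q

theorem Pw.syl_left {x : X} {p : M m} (h : Pw x p) (y : X) : Syl x y p :=
  ⟨p, 1, Or.inl ⟨h, pw_one⟩, (mul_one p).symm⟩

theorem Pw.syl_right {y : X} {p : M m} (h : Pw y p) (x : X) : Syl x y p :=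
  ⟨p, 1, Or.inr ⟨h, pw_one⟩, (mul_one p).symm⟩

omit [ThreeFree m] in
theorem Syl.symm {x y : X} {ξ : M m} (h : Syl x y ξ) : Syl y x ξ := by
  obtain ⟨p, q, h1, h2⟩ := h
  exact ⟨p, q, h1.symm, h2⟩

theorem Syl.not_full {x y z : X} {k : ℕ} {ω p : M m} (hω : Syl x y ω) (hl : Lab m x y k)
    (hk : m x y ≠ 2) (hp : Pw z p) (hr : Red (ω * p)) (hf : Full x y (ω * p)) : False := by
  obtain ⟨p₁, p₂, h | h, rfl⟩ := hω <;> exact not_full_of_three hl h.1 h.2 hp hk hr hf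

section

variable {n : ℕ} (hG : Good m n)
include hG

theorem exists_mul_of_eq {x z : X} {c₁ ζ c p : M m} (hf : Free x z c₁) (ho : Ov x z ζ)
    (hr : Red (c₁ * ζ)) (hn : ln (c₁ * ζ) ≤ n) (hp : Ov x z p) (h : c₁ * ζ = c * p) :
    ∃ ω, Ov x z ω ∧ ζ = ω * p ∧ c = c₁ * ω := by
  induction p using M_induction generalizing ζ with
  | one => exact ⟨ζ, ho, (mul_one _).symm, by rw [h, mul_one]⟩
  | mul p s ih =>
    rw [ov_mul, ov_g] at hp
    rw [← mul_assoc] at h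
    obtain ⟨η, hη, rfl, h1⟩ := decomp_d hG hf ho hr hn hp.2 h
    rw [← mul_assoc] at hr
    simp only [ln_mul, ln_g] at hn
    obtain ⟨ω, hω, rfl, h2⟩ := ih hη hr.left (by rw [ln_mul]; omega) hp.1 h1.symm
    exact ⟨ω, hω, mul_assoc _ _ _, h2⟩

theorem exists_full {x z : X} {c : M m} (hr : Red c) (hn : ln c ≤ n) (hx : DN c x) (hz : DN c z)
    (hxz : x ≠ z) : ∃ k c₁ ζ, Lab m x z k ∧ c = c₁ * ζ ∧ Free x z c₁ ∧ Full x z ζ := by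
  obtain ⟨s, rfl, a, rfl⟩ := hx
  obtain ⟨t, rfl, b, h⟩ := hz
  rcases hG _ _ _ _ hr hn h with ⟨rfl, rfl⟩ | ⟨-, ⟨k, hl⟩, e, η, θ, hf, ho, ho', hηθ, rfl, rfl⟩
  · exact absurd rfl hxz
  · exact ⟨k, e, η * g m s, hl, mul_assoc _ _ _, hf, ov_mul.2 ⟨ho, ov_g.2 (Or.inl rfl)⟩,
      ⟨s, rfl, d_mul_g _ _⟩, ⟨t, rfl, θ, hηθ⟩⟩

theorem exists_swap {a b : M m} {s t : X × Bool} (hr : Red (a * g m s)) (hn : ln (a * g m s) ≤ n)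
    (hst : s.1 ≠ t.1) (hm : m s.1 t.1 = 2) (h : a * g m s = b * g m t) :
    ∃ f, a = f * g m t ∧ b = f * g m s := by
  rcases hG _ _ _ _ hr hn h with ⟨rfl, rfl⟩ | ⟨-, -, e, η, θ, -, ho, -, hηθ, rfl, rfl⟩
  · exact absurd rfl hst
  · rw [mul_assoc] at hr
    obtain ⟨κ, -, rfl, rfl⟩ := exists_common (lab_two hst hm)
      (ov_mul.2 ⟨ho, ov_g.2 (Or.inl rfl)⟩) hr.right hηθ hst
    exact ⟨e * κ, (mul_assoc _ _ _).symm, (mul_assoc _ _ _).symm⟩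

theorem exists_pass {a b p : M m} {t : X × Bool} (hr : Red (a * p)) (hn : ln (a * p) ≤ n)
    (hp : ∀ u ∈ supp p, u ≠ t.1 ∧ m u t.1 = 2) (h : a * p = b * g m t) :
    ∃ f, a = f * g m t ∧ b = f * p := by
  induction p using M_induction generalizing b with
  | one => exact ⟨b, by rw [← h, mul_one], (mul_one _).symm⟩
  | mul p s ih =>
    have hs := hp s.1 (by simp)
    rw [← mul_assoc] at h hr hn
    obtain ⟨e, h1, rfl⟩ := exists_swap hG hr hn hs.1 hs.2 h
    rw [ln_mul] at hn
    obtain ⟨f, rfl, rfl⟩ := ih hr.left (by omega) (fun u hu => hp u (by simp [hu])) h1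
    exact ⟨f, rfl, mul_assoc _ _ _⟩

theorem exists_swap_pw {x z : X} (hxz : x ≠ z) (hm : m x z = 2) {h h' p p' : M m} (hp : Pw x p)
    (hp' : Pw z p') (hr : Red (h * p)) (hn : ln (h * p) ≤ n) (he : h * p = h' * p') :
    ∃ f, h = f * p' ∧ h' = f * p := by
  induction p' using M_induction generalizing h with
  | one => exact ⟨h, (mul_one _).symm, by rw [he, mul_one]⟩
  | mul p' t ih =>
    rw [pw_mul, pw_g] at hp'
    obtain ⟨hp', rfl⟩ := hp'
    rw [← mul_assoc] at he
    obtain ⟨f, rfl, h1⟩ := exists_pass hG (t := t) hr hn (fun u hu => by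
      obtain rfl : u = x := hp hu
      exact ⟨hxz, hm⟩) he
    have hr' : Red (f * p) := by
      rw [he, h1] at hr
      exact hr.left
    obtain ⟨f, rfl, rfl⟩ := ih hp' hr' (by
      simp only [ln_mul] at hn ⊢
      omega) h1.symm
    exact ⟨f, mul_assoc _ _ _, rfl⟩

theorem exists_not_syl {x z : X} (hxz : x ≠ z) (hm : m x z ≠ 2) {f p : M m} (hp : Pw z p)
    (hr : Red (f * p)) (hn : ln (f * p) ≤ n) (hx : DN (f * p) x) (hz : DN (f * p) z) :
    ∃ e ω, f = e * ω ∧ Free x z e ∧ Ov x z ω ∧ ¬ Syl x z ω := by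
  obtain ⟨k, e, ζ, hl, he, hf, hζ⟩ := exists_full hG hr hn hx hz hxz
  rw [he] at hr hn
  obtain ⟨ω, hω, rfl, rfl⟩ := exists_mul_of_eq hG hf hζ.1 hr hn (hp.ov' x) he.symm
  exact ⟨e, ω, rfl, hf, hω, fun hs => hs.not_full hl hm hp hr.right hζ⟩

theorem q_aux (N : ℕ) (hN : N ≤ n) : ∀ {x y z : X} {c₀ ξ : M m}, ln (c₀ * ξ) = N → x ≠ y →
    x ≠ z → y ≠ z → Red (c₀ * ξ) → Free x y c₀ → Ov x y ξ → DN (c₀ * ξ) z → m y z ≠ 2 →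
    (m x z ≠ 2 → Pw x ξ ∨ Pw y ξ) ∧
    (m x z = 2 → m x y ≠ 2 → ∃ p q, Pw y p ∧ Pw x q ∧ ξ = p * q) := by
  induction N using Nat.strong_induction_on with
  | _ N ih =>
    have hsymm := ThreeFree.symm (m := m)
    have Q : ∀ {x y z : X} {c₀ ξ : M m}, ln (c₀ * ξ) = N → x ≠ y → x ≠ z → y ≠ z →
        Red (c₀ * ξ) → Free x y c₀ → Ov x y ξ → DN (c₀ * ξ) z → m y z ≠ 2 → m x z ≠ 2 →
        DN ξ x → Pw x ξ := by
      intro x y z c₀ ξ hln hxy hxz hyz hr hf ho hz hmyz hmxz hx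
      obtain ⟨η, p, rfl, hηx, hp⟩ := exists_strip x ξ
      rw [ov_mul] at ho
      by_cases hη : η = 1
      · rwa [hη, one_mul]
      have hηy := (ho.1.dn_or hη).resolve_left hηx
      have hp1 : p ≠ 1 := by
        rintro rfl
        rw [mul_one] at hx
        exact hηx hx
      have hlp : ln p ≠ 0 := fun h => hp1 (eq_one_of_ln h)
      rw [← mul_assoc] at hr hz hln
      have hx' : DN (c₀ * η * p) x := (hp.dn hp1).mul_left _
      exfalso
      obtain ⟨k, e, ζ, hl, he, hef, hζ⟩ := exists_full hG hr (by omega) hx' hz hxz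
      have hr' := hr
      rw [he] at hr'
      obtain ⟨ω, hω, rfl, h1⟩ := exists_mul_of_eq hG hef hζ.1 hr' (by rw [← he]; omega)
        (hp.ov z) he.symm
      rw [ln_mul] at hln
      have hN' : ln (e * ω) = ln (c₀ * η) := by rw [h1]
      have key := ih (ln (c₀ * η)) (by omega) (by omega) (x := x) (y := z) (z := y) hN' hxz hxy
        hyz.symm (h1 ▸ hr.left) hef hω (h1 ▸ hηy.mul_left c₀) (by rwa [hsymm])
      have : Syl x z ω := by
        by_cases hm : m x y = 2
        · obtain ⟨p, q, hp, hq, rfl⟩ := key.2 hm hmxz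
          exact ⟨p, q, Or.inr ⟨hp, hq⟩, rfl⟩
        · rcases key.1 hm with h | h
          · exact h.syl_left _
          · exact h.syl_right _
      exact this.not_full hl hmxz hp hr'.right hζ
    intro x y z c₀ ξ hln hxy hxz hyz hr hf ho hz hmyz
    refine ⟨fun hmxz => ?_, fun hmxz hmxy => ?_⟩
    · by_cases h1 : ξ = 1
      · rw [h1]
        exact Or.inl pw_one
      · rcases ho.dn_or h1 with h | h
        · exact Or.inl (Q hln hxy hxz hyz hr hf ho hz hmyz hmxz h)
        · exact Or.inr (Q hln hxy.symm hyz hxz hr hf.symm ho.symm hz hmxz hmyz h)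
    · obtain ⟨η, p, rfl, hηx, hp⟩ := exists_strip x ξ
      obtain ⟨θ, r, rfl, hθy, hq⟩ := exists_strip y η
      rw [ov_mul, ov_mul] at ho
      by_cases hθ : θ = 1
      · exact ⟨r, p, hq, hp, by rw [hθ, one_mul]⟩
      exfalso
      have hθx := (ho.1.1.dn_or hθ).resolve_right hθy
      have hr1 : r ≠ 1 := by
        rintro rfl
        rw [mul_one] at hηx
        exact hηx hθx
      have hlr : ln r ≠ 0 := fun h => hr1 (eq_one_of_ln h)
      rw [← mul_assoc] at hr hz hln
      obtain ⟨t, rfl, b, hb⟩ := hz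
      obtain ⟨f, hf1, -⟩ := exists_pass hG (t := t) hr (by omega) (fun u hu => by
        obtain rfl : u = x := hp hu
        exact ⟨hxz, hmxz⟩) hb
      have hz : DN (c₀ * (θ * r)) t.1 := ⟨t, rfl, f, hf1⟩
      have hy : DN (c₀ * (θ * r)) y := ((hq.dn hr1).mul_left θ).mul_left c₀
      rw [← mul_assoc] at hz hy hr hln
      rw [ln_mul] at hln
      obtain ⟨k, e, ζ, hl, he, hef, hζ⟩ := exists_full hG hr.left (by omega) hz hy hyz.symm
      have hr' := hr.left
      rw [he] at hr'
      obtain ⟨ω, hω, rfl, h1⟩ := exists_mul_of_eq hG hef hζ.1 hr' (by rw [← he]; omega)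
        (hq.ov' t.1) he.symm
      rw [ln_mul] at hln
      have hN' : ln (e * ω) = ln (c₀ * θ) := by rw [h1]
      obtain ⟨p', q', hp', hq', rfl⟩ := (ih (ln (c₀ * θ)) (by omega) (by omega) (x := t.1) (y := y)
        (z := x) hN' hyz.symm hxz.symm hxy.symm (h1 ▸ hr.left.left) hef hω
        (h1 ▸ hθx.mul_left c₀) (by rwa [hsymm])).2 (by rwa [hsymm]) (by rwa [hsymm])
      exact not_full_of_three hl hp' hq' hq (by rwa [hsymm]) hr'.right hζ

theorem pw_or_pw {x y z : X} {c₀ ξ : M m} (hn : ln (c₀ * ξ) ≤ n) (hxy : x ≠ y) (hxz : x ≠ z)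
    (hyz : y ≠ z) (hr : Red (c₀ * ξ)) (hf : Free x y c₀) (ho : Ov x y ξ) (hz : DN (c₀ * ξ) z)
    (hmyz : m y z ≠ 2) (hmxz : m x z ≠ 2) : Pw x ξ ∨ Pw y ξ :=
  (q_aux hG _ hn rfl hxy hxz hyz hr hf ho hz hmyz).1 hmxz

theorem exists_pw_mul_pw {x y z : X} {c₀ ξ : M m} (hn : ln (c₀ * ξ) ≤ n) (hxy : x ≠ y)
    (hxz : x ≠ z) (hyz : y ≠ z) (hr : Red (c₀ * ξ)) (hf : Free x y c₀) (ho : Ov x y ξ)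
    (hz : DN (c₀ * ξ) z) (hmyz : m y z ≠ 2) (hmxz : m x z = 2) (hmxy : m x y ≠ 2) :
    ∃ p q, Pw y p ∧ Pw x q ∧ ξ = p * q :=
  (q_aux hG _ hn rfl hxy hxz hyz hr hf ho hz hmyz).2 hmxz hmxy

theorem syl_of_dn {x y z : X} {c₀ ξ : M m} (hn : ln (c₀ * ξ) ≤ n) (hxy : x ≠ y) (hxz : x ≠ z)
    (hyz : y ≠ z) (hr : Red (c₀ * ξ)) (hf : Free x y c₀) (ho : Ov x y ξ) (hz : DN (c₀ * ξ) z)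
    (hmyz : m y z ≠ 2) (hmxy : m x y ≠ 2) : Syl x y ξ := by
  by_cases hm : m x z = 2
  · obtain ⟨p, q, hp, hq, rfl⟩ := exists_pw_mul_pw hG hn hxy hxz hyz hr hf ho hz hmyz hm hmxy
    exact ⟨p, q, Or.inr ⟨hp, hq⟩, rfl⟩
  · rcases pw_or_pw hG hn hxy hxz hyz hr hf ho hz hmyz hm with h | h
    · exact h.syl_left _
    · exact h.syl_right _

end

end ThreeFree

namespace ThreeFree

open Dihedral

variable {X : Type*} {m : X → X → ℕ∞}

theorem SL.eq {a b : M m} {s t : X × Bool} (h : SL a s b t) : a * g m s = b * g m t := by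
  rcases h with ⟨rfl, rfl⟩ | ⟨-, -, c, η, θ, -, -, -, h, rfl, rfl⟩
  · rfl
  · rw [mul_assoc, mul_assoc, h]

/-- The strong link in the case of different names. -/
theorem SL.of_ne {a b : M m} {s t : X × Bool} (h : SL a s b t) (hst : s.1 ≠ t.1) :
    (∃ k, Lab m s.1 t.1 k) ∧ ∃ c η θ, Free s.1 t.1 c ∧ Ov s.1 t.1 η ∧ Ov s.1 t.1 θ ∧
      η * g m s = θ * g m t ∧ a = c * η ∧ b = c * θ := by
  rcases h with ⟨-, rfl⟩ | ⟨-, h⟩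
  · exact absurd rfl hst
  · exact h

variable [ThreeFree m]

theorem Lk.sl {a b : M m} {s t : X × Bool} (h : Lk (a, s) (b, t)) : SL a s b t := by
  obtain ⟨hst, hl, e, η, θ, hη, hθ, hηθ, h1, h2⟩ := h
  dsimp only at *
  obtain ⟨c, κ, rfl, hf, hκ⟩ := exists_decomp s.1 t.1 e
  exact Or.inr ⟨hst, hl, c, κ * η, κ * θ, hf, ov_mul.2 ⟨hκ, hη⟩, ov_mul.2 ⟨hκ, hθ⟩,
    by rw [mul_assoc, mul_assoc, hηθ], by rw [h1, mul_assoc], by rw [h2, mul_assoc]⟩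

theorem SL.exists_swap {a b : M m} {s t : X × Bool} (h : SL a s b t) (hr : Red (a * g m s))
    (hst : s.1 ≠ t.1) (hm : m s.1 t.1 = 2) : ∃ f, a = f * g m t ∧ b = f * g m s := by
  obtain ⟨-, e, η, θ, -, ho, -, hηθ, rfl, rfl⟩ := h.of_ne hst
  rw [mul_assoc] at hr
  obtain ⟨κ, -, rfl, rfl⟩ := exists_common (lab_two hst hm)
    (ov_mul.2 ⟨ho, ov_g.2 (Or.inl rfl)⟩) hr.right hηθ hst
  exact ⟨e * κ, (mul_assoc _ _ _).symm, (mul_assoc _ _ _).symm⟩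

theorem SL.dn {a b : M m} {s t : X × Bool} (h : SL a s b t) (hr : Red (a * g m s))
    (hst : s.1 ≠ t.1) : DN a t.1 := by
  obtain ⟨⟨k, hl⟩, e, η, θ, -, ho, -, hηθ, rfl, rfl⟩ := h.of_ne hst
  rw [mul_assoc] at hr
  obtain ⟨r, κ, hrt, -, rfl⟩ := exists_d_of_full hl
    (ov_mul.2 ⟨ho, ov_g.2 (Or.inl rfl)⟩) hr.right hηθ hst
  exact ⟨r, hrt, e * κ, (mul_assoc _ _ _).symm⟩

section

variable {n : ℕ} (hG : Good m n)
include hG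

theorem SL.trans_same {a b d : M m} {s t r : X × Bool} (h₁ : SL a s b t) (h₂ : SL b t d r)
    (hr : Red (a * g m s)) (hn : ln b ≤ n) (hst : s.1 ≠ t.1) (hrs : r.1 = s.1) :
    SL a s d r := by
  have hrb : Red (b * g m t) := h₁.eq ▸ hr
  obtain ⟨⟨k, hl⟩, c₁, η, θ, hf, hη, hθ, hηθ, rfl, rfl⟩ := h₁.of_ne hst
  obtain ⟨-, c₂, η', θ', hf', hη', hθ', hηθ', hb, rfl⟩ := h₂.of_ne (by rw [hrs]; exact hst.symm)
  rw [hrs] at hf' hη' hθ'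
  obtain ⟨rfl, rfl⟩ := decomp_unique hG hf hθ hrb.left hn hf'.symm hη'.symm hb
  rw [mul_assoc] at hr
  have ho : Ov s.1 t.1 (η * g m s) := ov_mul.2 ⟨hη, ov_g.2 (Or.inl rfl)⟩
  have ho' : Ov s.1 t.1 (θ' * g m r) := ov_mul.2 ⟨hθ'.symm, ov_g.2 (Or.inl hrs)⟩
  have he := hηθ.trans hηθ'
  rcases eq_or_eq_inv hrs with rfl | rfl
  · obtain rfl := cancel hl ho ho' hr.right he
    exact Or.inl ⟨rfl, rfl⟩
  · exact (not_d_inv hl ho hr.right he).elim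

theorem SL.two_of_ne_two {a b : M m} {s t : X × Bool} {z : X} (h : SL a s b t)
    (hr : Red (a * g m s)) (hn : ln b ≤ n) (hst : s.1 ≠ t.1) (hz : DN b z) (hsz : s.1 ≠ z)
    (htz : t.1 ≠ z) (hm : m s.1 t.1 ≠ 2) : m s.1 z = 2 ∧ m t.1 z = 2 := by
  have hrb : Red (b * g m t) := h.eq ▸ hr
  obtain ⟨⟨k, hl⟩, c, η, θ, hf, hη, hθ, hηθ, rfl, rfl⟩ := h.of_ne hst
  have key : ¬ Syl s.1 t.1 θ := fun hs => by
    rw [mul_assoc] at hrb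
    exact hs.not_full (p := g m t) hl hm (pw_g.2 rfl) hrb.right
      ⟨ov_mul.2 ⟨hθ, ov_g.2 (Or.inr rfl)⟩, ⟨s, rfl, η, hηθ.symm⟩, ⟨t, rfl, θ, rfl⟩⟩
  by_contra hc
  rcases not_and_or.1 hc with hc | hc
  · exact key (syl_of_dn hG hn hst.symm htz hsz hrb.left hf.symm hθ.symm hz hc
      (by rwa [ThreeFree.symm (m := m)])).symm
  · exact key (syl_of_dn hG hn hst hsz htz hrb.left hf hθ hz hc hm)

theorem SL.trans_of_two {a b d : M m} {s t r : X × Bool} (h₁ : SL a s b t) (h₂ : SL b t d r)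
    (hr : Red (a * g m s)) (hn : ln b ≤ n) (hst : s.1 ≠ t.1) (htr : t.1 ≠ r.1) (hsr : s.1 ≠ r.1)
    (hm₁ : m s.1 t.1 = 2) (hm₂ : m t.1 r.1 = 2) : SL a s d r := by
  have hrb : Red (b * g m t) := h₁.eq ▸ hr
  obtain ⟨b₁, rfl, rfl⟩ := h₁.exists_swap hr hst hm₁
  obtain ⟨b₂, hb, rfl⟩ := h₂.exists_swap hrb htr hm₂
  have h := hG _ _ _ _ hrb.left hn hb
  obtain ⟨hl, c, γ, γ', hf, hγ, hγ', he, rfl, rfl⟩ := h.of_ne hsr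
  have hc : ∀ γ, Ov s.1 r.1 γ → c * γ * g m t = c * g m t * γ := fun γ ho => by
    rw [mul_assoc, mul_assoc, comm_of_supp fun u hu => ?_]
    rcases ho hu with rfl | rfl
    · exact ⟨hst, hm₁⟩
    · exact ⟨htr.symm, by rwa [ThreeFree.symm (m := m)]⟩
  rw [hc γ hγ] at hr ⊢
  rw [hc γ' hγ']
  refine Or.inr ⟨hsr, hl, c * g m t, γ, γ', ?_, hγ, hγ', he, rfl, rfl⟩
  have hred := hr.left.left
  have hln : ln (c * g m t) ≤ n := by
    simp only [ln_mul, ln_g] at hn ⊢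
    omega
  constructor
  · rintro ⟨q, hq, u, hu⟩
    have := (hG _ _ _ _ hred hln hu).dn hred (by rw [hq]; exact hst.symm)
    rw [hq] at this
    exact hf.1 this
  · rintro ⟨q, hq, u, hu⟩
    have := (hG _ _ _ _ hred hln hu).dn hred (by rw [hq]; exact htr)
    rw [hq] at this
    exact hf.2 this

theorem SL.trans_of_pass {a b d : M m} {s t r : X × Bool} (h₁ : SL a s b t) (h₂ : SL b t d r)
    (hr : Red (a * g m s)) (hn : ln b ≤ n) (hst : s.1 ≠ t.1) (htr : t.1 ≠ r.1) (hsr : s.1 ≠ r.1)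
    (hm₁ : m s.1 r.1 = 2) (hm₂ : m t.1 r.1 = 2) : SL a s d r := by
  have hrb : Red (b * g m t) := h₁.eq ▸ hr
  obtain ⟨-, c, η, θ, hf, hη, hθ, he, rfl, rfl⟩ := h₁.of_ne hst
  obtain ⟨b', hb, rfl⟩ := h₂.exists_swap hrb htr hm₂
  have hc : ∀ γ : M m, Ov s.1 t.1 γ → ∀ u ∈ supp γ, u ≠ r.1 ∧ m u r.1 = 2 := by
    rintro γ ho u hu
    rcases ho hu with rfl | rfl
    · exact ⟨hsr, hm₁⟩
    · exact ⟨htr, hm₂⟩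
  obtain ⟨f, rfl, rfl⟩ := exists_pass hG hrb.left hn (hc θ hθ) hb
  refine Lk.sl ⟨hsr, ⟨2, lab_two hsr hm₁⟩, f * η, g m r, g m s, ov_g.2 (Or.inr rfl),
    ov_g.2 (Or.inl rfl), (comm hsr hm₁).symm, ?_, ?_⟩
  · dsimp only
    rw [mul_assoc, ← comm_of_supp (hc η hη), mul_assoc]
  · dsimp only
    rw [mul_assoc, ← he, mul_assoc]

theorem SL.trans {a b d : M m} {s t r : X × Bool} (h₁ : SL a s b t) (h₂ : SL b t d r)
    (hr : Red (a * g m s)) (hn : ln (a * g m s) ≤ n + 1) : SL a s d r := by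
  have hsymm := ThreeFree.symm (m := m)
  rcases Classical.em (s.1 = t.1) with hst | hst
  · rcases h₁ with ⟨rfl, rfl⟩ | ⟨h, -⟩
    · exact h₂
    · exact absurd hst h
  rcases Classical.em (t.1 = r.1) with htr | htr
  · rcases h₂ with ⟨rfl, rfl⟩ | ⟨h, -⟩
    · exact h₁
    · exact absurd htr h
  have hrb : Red (b * g m t) := h₁.eq ▸ hr
  have hrd : Red (d * g m r) := h₂.eq ▸ hrb
  have hb : ln b ≤ n := by
    rw [h₁.eq, ln_mul, ln_g] at hn
    omega
  rcases Classical.em (r.1 = s.1) with hrs | hrs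
  · exact h₁.trans_same hG h₂ hr hb hst hrs
  have hbs : DN b s.1 := h₁.symm.dn hrb (Ne.symm hst)
  have hbr : DN b r.1 := h₂.dn hrb htr
  by_cases hm₁ : m s.1 t.1 = 2
  · by_cases hm₂ : m t.1 r.1 = 2
    · exact h₁.trans_of_two hG h₂ hr hb hst htr (Ne.symm hrs) hm₁ hm₂
    · have h := h₂.symm.two_of_ne_two hG hrd hb (Ne.symm htr) hbs hrs (Ne.symm hst)
        (by rwa [hsymm])
      exact (h₂.symm.trans_of_pass hG h₁.symm hrd hb (Ne.symm htr) (Ne.symm hst) hrs h.1 h.2).symm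
  · have h := h₁.two_of_ne_two hG hr hb hst hbr (Ne.symm hrs) htr hm₁
    exact h₁.trans_of_pass hG h₂ hr hb hst htr (Ne.symm hrs) h.1 h.2

theorem Good.succ : Good m (n + 1) := by
  intro a s b t hr hn h
  suffices H : ∀ p q : M m × (X × Bool), Relation.EqvGen Lk p q →
      p.1 * g m p.2 = q.1 * g m q.2 ∧ (Red (p.1 * g m p.2) → ln (p.1 * g m p.2) ≤ n + 1 →
        SL p.1 p.2 q.1 q.2) from (H _ _ (eqvGen_lk h)).2 hr hn
  intro p q h
  induction h with
  | rel p q h => exact ⟨h.sl.eq, fun _ _ => h.sl⟩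
  | refl p => exact ⟨rfl, fun _ _ => Or.inl ⟨rfl, rfl⟩⟩
  | symm p q _ ih => exact ⟨ih.1.symm, fun h1 h2 => (ih.2 (ih.1 ▸ h1) (ih.1 ▸ h2)).symm⟩
  | trans p q r _ _ ih1 ih2 =>
    exact ⟨ih1.1.trans ih2.1, fun h1 h2 =>
      (ih1.2 h1 h2).trans hG (ih2.2 (ih1.1 ▸ h1) (ih1.1 ▸ h2)) h1 h2⟩

end

variable (m) in
theorem good (n : ℕ) : Good m n := by
  induction n with
  | zero =>
    intro a s b t _ h
    simp at h
  | succ n ih => exact ih.succ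

theorem not_both_not_syl {a b c : X} (hab : a ≠ b) (hbc : b ≠ c) (hac : a ≠ c)
    (hmab : m a b ≠ 2) (hmbc : m b c ≠ 2) (hmac : m a c = 2) {e₁ e₂ ξ ζ : M m}
    (hr : Red (e₁ * ξ)) (hf : Free a b e₁) (ho : Ov a b ξ) (hs : ¬ Syl a b ξ) (hf' : Free b c e₂)
    (ho' : Ov b c ζ) (hs' : ¬ Syl b c ζ) (he : e₁ * ξ = e₂ * ζ) : False := by
  have hsymm := ThreeFree.symm (m := m)
  induction hN : ln (e₁ * ξ) using Nat.strong_induction_on generalizing e₁ e₂ ξ ζ with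
  | _ N ih =>
    have hG := good m N
    have hr' : Red (e₂ * ζ) := he ▸ hr
    obtain ⟨f, β, hfβ, hfb, hβ⟩ := exists_strip b (e₁ * ξ)
    obtain ⟨ρ, hρ, rfl, rfl⟩ := exists_mul_of_eq hG hf ho hr hN.le (hβ.ov' a) hfβ
    obtain ⟨ρ', hρ', rfl, h1⟩ := exists_mul_of_eq hG hf' ho' hr' (he ▸ hN.le) (hβ.ov c)
      (he.symm.trans hfβ)
    have hρ1 : ρ ≠ 1 := by
      rintro rfl
      rw [one_mul] at hs
      exact hs (hβ.syl_right a)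
    have hρ1' : ρ' ≠ 1 := by
      rintro rfl
      rw [one_mul] at hs'
      exact hs' (hβ.syl_left c)
    have hρa := (hρ.dn_or hρ1).resolve_right fun h => hfb (h.mul_left _)
    have hρc := (hρ'.dn_or hρ1').resolve_left fun h => hfb (h1 ▸ h.mul_left _)
    rw [hfβ] at hr
    have hr := hr.left
    have hr' : Red (e₂ * ρ') := h1 ▸ hr
    have hln : ln (e₁ * ρ) ≤ N := by
      rw [hfβ, ln_mul] at hN
      omega
    obtain ⟨p, pa, hp, hpa, rfl⟩ := exists_pw_mul_pw hG hln hab hac hbc hr hf hρ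
      (h1 ▸ hρc.mul_left e₂) hmbc hmac hmab
    obtain ⟨q, pc, hq, hpc, rfl⟩ := exists_pw_mul_pw hG (h1 ▸ hln) hbc.symm hac.symm hab.symm hr'
      hf'.symm hρ'.symm (h1 ▸ hρa.mul_left e₁) (by rwa [hsymm]) (by rwa [hsymm]) (by rwa [hsymm])
    have hp1 : p ≠ 1 := by
      rintro rfl
      rw [one_mul] at hs
      exact hs ⟨pa, β, Or.inl ⟨hpa, hβ⟩, rfl⟩
    have hq1 : q ≠ 1 := by
      rintro rfl
      rw [one_mul] at hs'
      exact hs' ⟨pc, β, Or.inr ⟨hpc, hβ⟩, rfl⟩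
    have hpa1 : pa ≠ 1 := by
      rintro rfl
      rw [mul_one] at hρa
      exact not_dn_of_pw hab.symm hp hρa
    have hpc1 : pc ≠ 1 := by
      rintro rfl
      rw [mul_one] at hρc
      exact not_dn_of_pw hbc hq hρc
    rw [← mul_assoc, ← mul_assoc] at h1
    rw [← mul_assoc] at hr hr' hln
    obtain ⟨u, h2, h3⟩ := exists_swap_pw hG hac hmac hpa hpc hr hln h1
    have hl1 : ln (u * pc) < N ∧ ln (u * pa) < N := by
      have hlpa : ln pa ≠ 0 := fun h => hpa1 (eq_one_of_ln h)
      have hlpc : ln pc ≠ 0 := fun h => hpc1 (eq_one_of_ln h)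
      rw [h2] at hln
      simp only [ln_mul] at hln ⊢
      omega
    have hr1 : Red (u * pc) := h2 ▸ hr.left
    have hr2 : Red (u * pa) := h3 ▸ hr'.left
    obtain ⟨e₃, ω, hu, hf₃, hω, hs₃⟩ := exists_not_syl hG hbc hmbc hpc hr1 hl1.1.le
      (h2 ▸ (hp.dn hp1).mul_left e₁) ((hpc.dn hpc1).mul_left u)
    obtain ⟨e₄, ω', hu', hf₄, hω', hs₄⟩ := exists_not_syl hG hab.symm (by rwa [hsymm]) hpa hr2
      hl1.2.le (h3 ▸ (hq.dn hq1).mul_left e₂) ((hpa.dn hpa1).mul_left u)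
    refine ih (ln (e₄ * ω')) ?_ (hu' ▸ hr1.left) hf₄.symm hω'.symm (fun h => hs₄ h.symm) hf₃ hω
      hs₃ (hu'.symm.trans hu) rfl
    rw [← hu']
    have := hl1.1
    rw [ln_mul] at this
    omega

theorem last_letter_bcba {a b c : X} (hab : a ≠ b) (hbc : b ≠ c) (hac : a ≠ c)
    (hmab : m a b ≠ 2) (hmbc : m b c ≠ 2) {u v : M m} {s₁ s₂ s₃ s₄ t : X × Bool} (h₁ : s₁.1 = b)
    (h₂ : s₂.1 = c) (h₃ : s₃.1 = b) (h₄ : s₄.1 = a)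
    (hr : Red (u * g m s₁ * g m s₂ * g m s₃ * g m s₄))
    (h : u * g m s₁ * g m s₂ * g m s₃ * g m s₄ = v * g m t) : t.1 = a ∨ m a t.1 = 2 := by
  have hsymm := ThreeFree.symm (m := m)
  by_contra hc
  rw [not_or] at hc
  obtain ⟨hta, hmt⟩ := hc
  have hat : a ≠ t.1 := Ne.symm hta
  have hG := good m (ln (u * g m s₁ * g m s₂ * g m s₃ * g m s₄))
  have hsl := hG _ _ _ _ hr le_rfl h
  obtain ⟨⟨k, hl⟩, e, η, θ, hf, hη, hθ, hηθ, he, rfl⟩ := hsl.of_ne (h₄ ▸ hat)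
  rw [h₄] at hl hf hη hθ
  have hr₀ := hr.left
  have hln : ln (e * η) ≤ ln (u * g m s₁ * g m s₂ * g m s₃ * g m s₄) := by
    rw [← he, ln_mul _ (g m s₄)]
    omega
  have hs : ¬ Syl a t.1 η := fun hs => by
    rw [he, mul_assoc] at hr
    exact hs.not_full hl hmt (pw_g.2 h₄) hr.right ⟨ov_mul.2 ⟨hη, ov_g.2 (Or.inl h₄)⟩,
      ⟨s₄, h₄, d_mul_g _ _⟩, ⟨t, rfl, θ, hηθ⟩⟩
  have hb : DN (e * η) b := he ▸ ⟨s₃, h₃, d_mul_g _ _⟩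
  rcases eq_or_ne t.1 b with htb | htb
  · rw [htb] at hl hf hη hθ hs hmt
    rw [he] at hr₀
    obtain ⟨η₁, hη₁, rfl, h5⟩ := decomp_d hG hf hη hr₀ hln (Or.inr h₃) he.symm
    rw [← mul_assoc] at hr₀ hln
    rw [ln_mul] at hln
    have hc : DN (e * η₁) c := h5 ▸ ⟨s₂, h₂, d_mul_g _ _⟩
    by_cases hmac : m a c = 2
    · obtain ⟨p, q, hp, hq, rfl⟩ := exists_pw_mul_pw hG (by omega) hab hac hbc hr₀.left hf hη₁ hc
        hmbc hmac hmab
      have hp1 : p ≠ 1 := by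
        rintro rfl
        rw [one_mul] at hs
        exact hs ⟨q, g m s₃, Or.inl ⟨hq, pw_g.2 h₃⟩, rfl⟩
      have hq1 : q ≠ 1 := by
        rintro rfl
        rw [mul_one] at hs
        exact hs (Pw.syl_right (pw_mul.2 ⟨hp, pw_g.2 h₃⟩) a)
      rw [← mul_assoc] at hr₀ hln h5
      obtain ⟨f, h6, h7⟩ := exists_pass hG hr₀.left (by omega) (fun w hw => by
        obtain rfl : w = a := hq hw
        exact ⟨h₂ ▸ hac, h₂ ▸ hmac⟩) h5.symm
      have hr₁ := hr₀.left.left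
      rw [h6] at hr₁
      have hr₂ := (h5 ▸ hr₀.left).left
      rw [h7] at hr₂
      have hln1 := congrArg ln h5
      have hln2 := congrArg ln h6
      have hln3 := congrArg ln h7
      simp only [ln_mul] at hln hln1 hln2 hln3
      obtain ⟨e₃, ω, hu, hf₃, hω, hs₃⟩ := exists_not_syl hG hbc hmbc (pw_g.2 h₂) hr₁
        (by simp only [ln_mul]; omega) (h6 ▸ (hp.dn hp1).mul_left e) ⟨s₂, h₂, d_mul_g _ _⟩
      obtain ⟨e₄, ω', hu', hf₄, hω', hs₄⟩ := exists_not_syl hG hab.symm (by rwa [hsymm]) hq hr₂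
        (by simp only [ln_mul]; omega) (h7 ▸ ⟨s₁, h₁, d_mul_g _ _⟩) ((hq.dn hq1).mul_left f)
      exact not_both_not_syl hab hbc hac hmab hmbc hmac (hu' ▸ hr₁.left) hf₄.symm hω'.symm
        (fun h => hs₄ h.symm) hf₃ hω hs₃ (hu'.symm.trans hu)
    · rcases pw_or_pw hG (by omega) hab hac hbc hr₀.left hf hη₁ hc hmbc hmac with h | h
      · exact hs ⟨η₁, g m s₃, Or.inl ⟨h, pw_g.2 h₃⟩, rfl⟩
      · exact hs (Pw.syl_right (pw_mul.2 ⟨h, pw_g.2 h₃⟩) a)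
  · rw [he] at hr₀
    exact hs (syl_of_dn hG hln hta htb hab hr₀ hf.symm hη.symm hb hmab
      (by rwa [hsymm])).symm

end ThreeFree

namespace ThreeFree

open Dihedral

variable {X : Type*} {m : X → X → ℕ∞}

open Classical in
/-- Right multiplication by a letter on reduced elements. -/
noncomputable def actR (s : X × Bool) (c : M m) : M m :=
  if h : D c (inv s) then h.choose else c * g m s

/-- Right multiplication by a word on reduced elements. -/
noncomputable def runR (w : Word X) (c : M m) : M m := w.foldl (fun c s => actR s c) c

theorem actR_of_not {s : X × Bool} {c : M m} (h : ¬ D c (inv s)) : actR s c = c * g m s :=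
  dif_neg h

variable [ThreeFree m]

theorem actR_mul_inv {s : X × Bool} {a : M m} (hr : Red (a * g m (inv s))) :
    actR s (a * g m (inv s)) = a := by
  have h : D (a * g m (inv s)) (inv s) := d_mul_g _ _
  rw [actR, dif_pos h]
  rcases good m _ _ _ _ _ hr le_rfl h.choose_spec with h | h
  · exact h.1.symm
  · exact absurd rfl h.1

theorem red_actR (s : X × Bool) {c : M m} (hr : Red c) : Red (actR s c) := by
  by_cases h : D c (inv s)
  · obtain ⟨a, rfl⟩ := h
    rw [actR_mul_inv hr]
    exact hr.left
  · rw [actR_of_not h]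
    exact red_append (good m _) le_rfl hr h

theorem actR_inv_actR (s : X × Bool) {c : M m} (hr : Red c) : actR (inv s) (actR s c) = c := by
  by_cases h : D c (inv s)
  · obtain ⟨a, rfl⟩ := h
    rw [actR_mul_inv hr, actR_of_not]
    rw [inv_inv]
    rintro ⟨b, rfl⟩
    exact hr b s 1 (mul_one _).symm
  · have h1 := red_actR s hr
    rw [actR_of_not h] at h1 ⊢
    have := actR_mul_inv (s := inv s) (a := c)
    rw [inv_inv] at this
    exact this h1

/-- Right multiplication by a letter as a permutation of the reduced elements. -/
noncomputable def permR (s : X × Bool) : Equiv.Perm {c : M m // Red c} where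
  toFun c := ⟨actR s c.1, red_actR s c.2⟩
  invFun c := ⟨actR (inv s) c.1, red_actR (inv s) c.2⟩
  left_inv c := Subtype.ext (actR_inv_actR s c.2)
  right_inv c := Subtype.ext (by simpa using actR_inv_actR (inv s) c.2)

section

variable {x y : X} {k : ℕ} (hl : Lab m x y k)
include hl

theorem exists_actR {c₀ ξ : M m} (hf : Free x y c₀) (ho : Ov x y ξ) (hr : Red (c₀ * ξ))
    {s : X × Bool} (hs : s.1 = x ∨ s.1 = y) : ∃ ζ, Ov x y ζ ∧ Red (c₀ * ζ) ∧
      actR s (c₀ * ξ) = c₀ * ζ ∧ st k x ζ = act k (toDi x s) (st k x ξ) := by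
  by_cases h : D (c₀ * ξ) (inv s)
  · obtain ⟨a, ha⟩ := h
    obtain ⟨η, hη, rfl, rfl⟩ := decomp_d (good m _) hf ho hr le_rfl (s := inv s) hs ha
    rw [ha] at hr
    refine ⟨η, hη, hr.left, by rw [ha, actR_mul_inv hr], ?_⟩
    rw [st_mul_g hl hη (s := inv s) hs, toDi_inv, act_act_inv hl.two_le _ (wf_st hl η)]
  · have hr' := red_append (good m _) le_rfl hr h
    rw [mul_assoc] at hr'
    exact ⟨ξ * g m s, ov_mul.2 ⟨ho, ov_g.2 hs⟩, hr', by rw [actR_of_not h, mul_assoc],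
      st_mul_g hl ho hs⟩

theorem exists_runR {c₀ ξ : M m} (hf : Free x y c₀) (ho : Ov x y ξ) (hr : Red (c₀ * ξ))
    {w : Word X} (hw : Over x y w) : ∃ ζ, Ov x y ζ ∧ Red (c₀ * ζ) ∧
      runR w (c₀ * ξ) = c₀ * ζ ∧ st k x ζ = run k (w.map (toDi x)) (st k x ξ) := by
  induction w generalizing ξ with
  | nil => exact ⟨ξ, ho, hr, rfl, rfl⟩
  | cons s w ih =>
    obtain ⟨η, hη, h1, h2, h3⟩ := exists_actR hl hf ho hr (hw s (by simp))
    obtain ⟨ζ, hζ, h4, h5, h6⟩ := ih hη h1 (fun p hp => hw p (by simp [hp]))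
    refine ⟨ζ, hζ, h4, ?_, ?_⟩
    · rw [← h5, ← h2]
      rfl
    · rw [h6, h3]
      rfl

theorem runR_eq_runR {w w' : Word X} (hw : Over x y w) (hw' : Over x y w')
    (h : ∀ ξ, WF k ξ → run k (w.map (toDi x)) ξ = run k (w'.map (toDi x)) ξ) {c : M m}
    (hr : Red c) : runR w c = runR w' c := by
  obtain ⟨c₀, ξ, rfl, hf, ho⟩ := exists_decomp x y c
  obtain ⟨ζ, hζ, h1, h2, h3⟩ := exists_runR hl hf ho hr hw
  obtain ⟨ζ', hζ', h1', h2', h3'⟩ := exists_runR hl hf ho hr hw'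
  rw [h2, h2', eq_of_st_eq hl hζ hζ' ((red_iff hl hζ).1 h1.right) ((red_iff hl hζ').1 h1'.right)
    (by rw [h3, h3', h _ (wf_st hl ξ)])]

end

/-- The alternating positive word of length `n` in `x` and `y`, starting with `x`. -/
def altW : ℕ → X → X → Word X
  | 0, _, _ => []
  | n + 1, x, y => (x, true) :: altW n y x

theorem over_altW (n : ℕ) (x y : X) : Over x y (altW n x y) := by
  induction n generalizing x y with
  | zero => simp [Over, altW]
  | succ n ih =>
    intro p hp
    rcases List.mem_cons.1 hp with rfl | hp
    · exact Or.inl rfl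
    · exact (ih y x p hp).symm

theorem map_toDi_altW {x y : X} (hxy : x ≠ y) (n : ℕ) :
    (altW n x y).map (toDi x) = altWord true n ∧ (altW n y x).map (toDi x) = altWord false n := by
  induction n with
  | zero => exact ⟨rfl, rfl⟩
  | succ n ih => simp [altW, altWord, ih, toDi, hxy.symm]

open MulOpposite in
theorem lift_altProd (n : ℕ) (x y : X) (c : {c : M m // Red c}) :
    ((unop (FreeGroup.lift (fun x : X => op (permR (m := m) (x, true))) (altProd n x y))) c).1 =
      runR (altW n x y) c.1 := by
  induction n generalizing x y c with
  | zero => simp [altProd, altW, runR]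
  | succ n ih =>
    rw [altProd, map_mul, FreeGroup.lift_apply_of, unop_mul, unop_op, Equiv.Perm.mul_apply, ih]
    rfl

variable (m) in
open MulOpposite in
/-- The right action of the Artin group on reduced elements. -/
noncomputable def actHom : ArtinGroup m →* (Equiv.Perm {c : M m // Red c})ᵐᵒᵖ :=
  PresentedGroup.toGroup (f := fun x : X => op (permR (m := m) (x, true))) <| by
    rintro _ ⟨x, y, k, hxy, hk, rfl⟩
    rw [map_mul, map_inv, mul_inv_eq_one]
    refine unop_injective (Equiv.ext fun c => Subtype.ext ?_)
    have hl : Lab m x y k := ⟨hxy, hk⟩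
    rw [lift_altProd, lift_altProd]
    refine runR_eq_runR hl (over_altW k x y) (fun p hp => (over_altW k y x p hp).symm) ?_ c.2
    intro ξ hξ
    rw [(map_toDi_altW hxy k).1, (map_toDi_altW hxy k).2]
    exact braid hl.two_le hξ _ _

open MulOpposite in
theorem actHom_evalWord (w : Word X) (c : {c : M m // Red c}) :
    ((unop (actHom m (evalWord (artinGen m) w))) c).1 = runR w c.1 := by
  induction w generalizing c with
  | nil => simp [evalWord, runR]
  | cons s w ih =>
    have hs : actHom m (if s.2 then artinGen m s.1 else (artinGen m s.1)⁻¹) = op (permR s) := by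
      obtain ⟨x, ε⟩ := s
      have hx : actHom m (artinGen m x) = op (permR (x, true)) := PresentedGroup.toGroup.of _
      cases ε
      · rw [if_neg (by simp), map_inv, hx]
        rfl
      · rw [if_pos rfl, hx]
    rw [evalWord, List.map_cons, List.prod_cons, map_mul, hs, unop_mul, Equiv.Perm.mul_apply]
    exact ih _

omit [ThreeFree m] in
theorem runR_one {w : Word X} (hr : Red (cl m w)) : runR w (1 : M m) = cl m w := by
  induction w using List.reverseRecOn with
  | nil => rfl
  | append_singleton w s ih =>
    rw [cl_append] at hr ⊢
    rw [runR, List.foldl_append]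
    change actR s (runR w 1) = _
    rw [ih hr.left, actR_of_not]
    · rfl
    · rintro ⟨a, ha⟩
      refine hr a (inv s) 1 ?_
      rw [ha, inv_inv, mul_one]
      rfl

theorem red_of_isGeodesic {w : Word X} (hw : IsGeodesic (artinGen m) w) : Red (cl m w) := by
  intro a s b h
  obtain ⟨u, rfl⟩ := cl_surj a
  obtain ⟨v, rfl⟩ := cl_surj b
  replace h : cl m w = cl m (u ++ [s] ++ [inv s] ++ v) := h
  have h1 := length_eq_of_cl_eq h
  have h2 := evalWord_eq_of_cl_eq h
  have h3 := hw (u ++ v) (by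
    rw [h2]
    obtain ⟨x, ε⟩ := s
    simp only [evalWord_append]
    cases ε <;> simp [evalWord, inv])
  simp only [List.length_append, List.length_singleton] at h1 h3
  omega

/-- Geodesic words representing the same element are related by dihedral relations preserving
the length. -/
theorem cl_eq_of_isGeodesic {v w : Word X} (hv : IsGeodesic (artinGen m) v)
    (hw : IsGeodesic (artinGen m) w) (h : evalWord (artinGen m) v = evalWord (artinGen m) w) :
    cl m v = cl m w := by
  rw [← runR_one (red_of_isGeodesic hv), ← runR_one (red_of_isGeodesic hw),
    ← actHom_evalWord v ⟨1, red_one⟩, ← actHom_evalWord w ⟨1, red_one⟩, h]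

end ThreeFree

/-- In a 3-free Artin group, if `a, b, c` are pairwise distinct generators with
`m a b > 3` and `m b c > 3`, and `w b^{δ₁} c^{δ₂} b^{δ₃} a^{δ₄}` is a geodesic word, then every
geodesic word representing the same element ends in a letter `a^±` or `z^±` for some generator
`z` with `m a z = 2` (a letter commuting with `a`). -/
theorem threeFree_equivalent_geodesic_last_letter_bcba {X : Type*} [Fintype X] (m : X → X → ℕ∞)
    (hsymm : ∀ x y : X, m x y = m y x) (hge2 : ∀ x y : X, x ≠ y → 2 ≤ m x y)
    (h3free : ∀ x y : X, x ≠ y → m x y ≠ 3)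
    (a b c : X) (hab : a ≠ b) (hbc : b ≠ c) (hac : a ≠ c)
    (hmab : 3 < m a b) (hmbc : 3 < m b c)
    (δ₁ δ₂ δ₃ δ₄ : Bool) (w : Word X)
    (hgeo : IsGeodesic (artinGen m) (w ++ [(b, δ₁), (c, δ₂), (b, δ₃), (a, δ₄)])) :
    ∀ v : Word X, IsGeodesic (artinGen m) v →
      evalWord (artinGen m) v =
        evalWord (artinGen m) (w ++ [(b, δ₁), (c, δ₂), (b, δ₃), (a, δ₄)]) →
      ∃ (z : X) (η : Bool), v.getLast? = some (z, η) ∧ (z = a ∨ m a z = 2) := by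
  intro v hv hvw
  have : ThreeFree m := ⟨hsymm, hge2, h3free⟩
  have hab2 : m a b ≠ 2 := fun h => by
    rw [h] at hmab
    exact absurd hmab (by decide)
  have hbc2 : m b c ≠ 2 := fun h => by
    rw [h] at hmbc
    exact absurd hmbc (by decide)
  have hcl := ThreeFree.cl_eq_of_isGeodesic hv hgeo hvw
  have hr := ThreeFree.red_of_isGeodesic hgeo
  rcases List.eq_nil_or_concat v with rfl | ⟨v, t, rfl⟩
  · have := ThreeFree.length_eq_of_cl_eq hcl
    simp at this
  · rw [List.concat_eq_append] at hcl ⊢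
    refine ⟨t.1, t.2, by simp, ?_⟩
    have he : ThreeFree.cl m (w ++ [(b, δ₁), (c, δ₂), (b, δ₃), (a, δ₄)]) =
        ThreeFree.cl m w * ThreeFree.g m (b, δ₁) * ThreeFree.g m (c, δ₂) *
          ThreeFree.g m (b, δ₃) * ThreeFree.g m (a, δ₄) := by
      simp only [mul_assoc]
      rfl
    rw [he] at hr hcl
    exact ThreeFree.last_letter_bcba (v := ThreeFree.cl m v) hab hbc hac hab2 hbc2 rfl rfl rfl rfl
      hr hcl.symm
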